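/- arXiv:0707.4339 — 2 statements merged into one kernel-verified Lean document; each statement's English description precedes it below -/
import Mathlib

section
/- If a smooth projective complete intersection X of four quadrics in ℙ⁷ admits a free action of a finite group G lifting to a linear action on ℂ⁸ (so that O_X(1) is G-linearized), then |G| divides 8. In particular no group of order greater than 8 acts freely and linearly on such an X. -/
open MvPolynomial

/-- `ℂ⁸` with coordinates indexed by `Fin 8`. -/
abbrev V8 := Fin 8 → ℂ

/-- `GL(8, ℂ)`, realized as the group of `ℂ`-linear automorphisms of `ℂ⁸`. -/
abbrev GL8 := V8 ≃ₗ[ℂ] V8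


lemma dimA {d k : ℕ} (p : Fin k → MvPolynomial (Fin d) ℂ)
    (h : ∀ v : Fin d → ℂ, (∀ j, eval v (p j) = 0) ↔ v = 0) : d ≤ k := by
  have key : ringKrullDim (MvPolynomial (Fin d) ℂ) ≤ k := by
    rw [ringKrullDim_le_iff_isMaximal_height_le]
    intro M hM
    obtain ⟨x, rfl⟩ := isMaximal_iff_eq_vanishingIdeal_singleton.1 hM
    set p' : Fin k → MvPolynomial (Fin d) ℂ := fun j => bind₁ (fun i => X i - C (x i)) (p j)
    have hz : zeroLocus ℂ (Ideal.span (Set.range p')) = {x} := by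
      rw [zeroLocus_span]
      ext v
      have : ∀ j, aeval v (p' j) = eval (v - x) (p j) := by
        intro j
        simp only [p', aeval_bind₁, map_sub, aeval_X, aeval_C, Algebra.algebraMap_self, RingHom.id_apply]
        rfl
      simp only [Set.mem_range, forall_exists_index, forall_apply_eq_imp_iff, Set.mem_ofPred_eq, this, h, sub_eq_zero, Set.mem_singleton_iff]
    have hr := vanishingIdeal_zeroLocus_eq_radical (K := ℂ) (Ideal.span (Set.range p'))
    rw [hz] at hr
    have hmin : vanishingIdeal ℂ {x} ∈ (Ideal.span (Set.range p')).minimalPrimes := by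
      rw [← Ideal.radical_minimalPrimes, ← hr, Ideal.minimalPrimes_eq_subsingleton_self]
      rfl
    have := Ideal.height_le_card_of_mem_minimalPrimes_span (Set.finite_range p') hmin
    have h2 := Set.ncard_image_le (f := p') (s := Set.univ) Set.finite_univ
    rw [Set.image_univ, Set.ncard_univ, Nat.card_fin] at h2
    have h3 : (vanishingIdeal ℂ {x}).height ≤ (k : ℕ∞) := this.trans (by exact_mod_cast h2)
    exact_mod_cast h3
  rw [MvPolynomial.ringKrullDim_of_isNoetherianRing, ringKrullDim_eq_zero_of_field] at key
  simpa using key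

/-- Lemma A -/
lemma dimA' {k : ℕ} (U : Submodule ℂ (Fin 8 → ℂ)) (F : Fin k → Matrix (Fin 8) (Fin 8) ℂ)
    (h : ∀ v ∈ U, (∀ j, v ⬝ᵥ (F j).mulVec v = 0) → v = 0) : Module.finrank ℂ U ≤ k := by
  let b := Module.finBasis ℂ U
  let lin : Fin 8 → MvPolynomial (Fin (Module.finrank ℂ U)) ℂ := fun a => ∑ i, C ((b i : Fin 8 → ℂ) a) * X i
  let p : Fin k → MvPolynomial (Fin (Module.finrank ℂ U)) ℂ := fun j =>
    ∑ a, ∑ c, lin a * (C (F j a c) * lin c)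
  have hlin : ∀ v a, eval v (lin a) = ((∑ i, v i • b i : U) : Fin 8 → ℂ) a := by
    intro v a
    simp [lin, Finset.sum_apply, mul_comm]
  have hp : ∀ v j, eval v (p j) = ((∑ i, v i • b i : U) : Fin 8 → ℂ) ⬝ᵥ (F j).mulVec ((∑ i, v i • b i : U) : Fin 8 → ℂ) := by
    intro v j
    simp only [p, map_sum, map_mul, eval_C, hlin, dotProduct, Matrix.mulVec, Finset.mul_sum]
  apply dimA p
  intro v
  simp only [hp]
  constructor
  · intro hv
    have h0 := h _ (Submodule.coe_mem _) hv
    have h1 : ∑ i, v i • b i = 0 := Subtype.ext h0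
    have := Fintype.linearIndependent_iff.1 b.linearIndependent v h1
    funext i; exact this i
  · rintro rfl j
    simp

lemma pderiv_comm' {σ : Type*} (j k : σ) (q : MvPolynomial σ ℂ) :
    pderiv j (pderiv k q) = pderiv k (pderiv j q) := by
  classical
  ext m
  simp only [coeff_pderiv, Finsupp.add_apply, Finsupp.single_apply, add_right_comm m _ _]
  by_cases h : j = k
  · subst h; rfl
  · simp [h, Ne.symm h]; ring

lemma polyMat (q : MvPolynomial (Fin 8) ℂ) (hq : q.IsHomogeneous 2) :
    ∃ A : Matrix (Fin 8) (Fin 8) ℂ, A.IsSymm ∧ (∀ v j, eval v (pderiv j q) = A.mulVec v j) ∧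
      ∀ v, 2 * eval v q = v ⬝ᵥ A.mulVec v := by
  refine ⟨Matrix.of fun j k => eval 0 (pderiv k (pderiv j q)), ?_, ?_, ?_⟩
  · ext j k
    simp only [Matrix.transpose_apply, Matrix.of_apply]
    rw [pderiv_comm']
  all_goals
    have h1 : ∀ v j, eval v (pderiv j q) = (Matrix.of fun j k => eval 0 (pderiv k (pderiv j q))).mulVec v j := by
      intro v j
      have hh : (pderiv j q).IsHomogeneous 1 := hq.pderiv
      have h0 : ∀ k, ∃ c, pderiv k (pderiv j q) = C c := fun k => by
        have : (pderiv k (pderiv j q)).IsHomogeneous 0 := hh.pderiv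
        exact ⟨_, (totalDegree_eq_zero_iff_eq_C.1 (by
          by_cases hz : pderiv k (pderiv j q) = 0
          · simp [hz]
          · exact this.totalDegree hz))⟩
      have := congrArg (eval v) hh.sum_X_mul_pderiv
      simp only [map_sum, map_mul, eval_X, one_smul] at this
      rw [← this]
      simp only [Matrix.mulVec, dotProduct, Matrix.of_apply]
      refine Finset.sum_congr rfl fun k _ => ?_
      obtain ⟨c, hc⟩ := h0 k
      rw [hc]; simp [mul_comm]
  · exact h1
  · intro v
    have := congrArg (eval v) hq.sum_X_mul_pderiv
    simp only [map_sum, map_mul, eval_X, h1] at this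
    simp only [dotProduct]
    rw [this]; simp
open Matrix Topology Filter

abbrev M8 := Matrix (Fin 8) (Fin 8) ℂ

/-- the affine cone -/
def InX (A : Fin 4 → M8) (v : V8) : Prop := ∀ i, v ⬝ᵥ A i *ᵥ v = 0

lemma exists_dual (a : Fin 4 → V8) (ha : LinearIndependent ℂ a) :
    ∃ P : Fin 4 → V8, ∀ i j, P i ⬝ᵥ a j = if i = j then 1 else 0 := by
  obtain ⟨g, hg⟩ := LinearMap.exists_leftInverse_of_injective (Fintype.linearCombination ℂ a)
    (LinearMap.ker_eq_bot.2 (by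
      exact ha.fintypeLinearCombination_injective))
  refine ⟨fun i j => g (Pi.single j 1) i, fun i j => ?_⟩
  have h1 : g (a j) = Pi.single j 1 := by
    have := LinearMap.congr_fun hg (Pi.single j 1)
    simpa [Fintype.linearCombination_apply_single] using this
  have h2 : a j = ∑ k, a j k • (Pi.single k 1 : V8) := by
    ext l; simp [Finset.sum_apply, Pi.single_apply]
  have h3 : g (a j) i = ∑ k, a j k * g (Pi.single k 1) i := by
    conv_lhs => rw [h2]
    simp [map_sum, Finset.sum_apply]
  rw [h1] at h3
  simp only [dotProduct, mul_comm (g _ i), ← h3, Pi.single_apply]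

lemma mem_span_of_ker (a : Fin 4 → V8) (ha : LinearIndependent ℂ a) (l : V8)
    (h : ∀ w, (∀ i, a i ⬝ᵥ w = 0) → l ⬝ᵥ w = 0) : ∃ c : Fin 4 → ℂ, l = ∑ i, c i • a i := by
  obtain ⟨P, hP⟩ := exists_dual a ha
  refine ⟨fun i => l ⬝ᵥ P i, ?_⟩
  have key : ∀ u, l ⬝ᵥ u = (∑ i, (l ⬝ᵥ P i) • a i) ⬝ᵥ u := by
    intro u
    have := h (u - ∑ i, (a i ⬝ᵥ u) • P i) (by
      intro j
      rw [dotProduct_sub, dotProduct_sum]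
      simp [dotProduct_comm (a j), hP])
    rw [dotProduct_sub, sub_eq_zero, dotProduct_sum] at this
    rw [this, sum_dotProduct]
    simp [mul_comm]
  exact dotProduct_eq _ _ key

lemma exists_curve (A : Fin 4 → M8) (hA : ∀ i, (A i).IsSymm) (v : V8) (hv : InX A v)
    (hind : LinearIndependent ℂ (fun i => A i *ᵥ v)) (w : V8)
    (hw : ∀ i, (A i *ᵥ v) ⬝ᵥ w = 0) :
    ∃ γ : ℂ → V8, ContDiffAt ℂ 1 γ 0 ∧ γ 0 = v ∧ HasDerivAt γ w 0 ∧ ∀ᶠ t in 𝓝 0, InX A (γ t) := by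
  obtain ⟨P, hP⟩ := exists_dual _ hind
  let Y : ℂ × (Fin 4 → ℂ) →ₗ[ℂ] V8 :=
    { toFun := fun z => z.1 • w + ∑ i, z.2 i • P i
      map_add' := by
        intro x y
        simp only [Prod.fst_add, Prod.snd_add, Pi.add_apply, add_smul, Finset.sum_add_distrib]
        abel
      map_smul' := by
        intro c x
        simp [smul_smul, Finset.smul_sum] }
  let Yc : ℂ × (Fin 4 → ℂ) →L[ℂ] V8 := LinearMap.toContinuousLinearMap Y
  let Φ : ℂ × (Fin 4 → ℂ) → ℂ × (Fin 4 → ℂ) := fun z =>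
    (z.1, fun i => z.2 i + (1/2) * ∑ a, ∑ b, Yc z a * (A i a b * Yc z b))
  have hquad : ∀ (z : ℂ × (Fin 4 → ℂ)) i, (v + Yc z) ⬝ᵥ A i *ᵥ (v + Yc z) = 2 * (Φ z).2 i := by
    intro z i
    have e1 : (Yc z) ⬝ᵥ A i *ᵥ (Yc z) = ∑ a, ∑ b, Yc z a * (A i a b * Yc z b) := by
      simp only [dotProduct, mulVec, Finset.mul_sum]
    have e2 : v ⬝ᵥ A i *ᵥ (Yc z) = (A i *ᵥ v) ⬝ᵥ Yc z := by
      rw [dotProduct_mulVec, ← mulVec_transpose, (hA i).eq]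
    have e3 : (A i *ᵥ v) ⬝ᵥ Yc z = z.2 i := by
      change (A i *ᵥ v) ⬝ᵥ (z.1 • w + ∑ i, z.2 i • P i) = _
      rw [dotProduct_add, dotProduct_smul, hw, dotProduct_sum]
      simp [dotProduct_comm (A i *ᵥ v), hP]
    rw [mulVec_add, add_dotProduct, dotProduct_add, dotProduct_add, hv i, e2, e1,
      dotProduct_comm (Yc z) (A i *ᵥ v), e3]
    simp only [Φ]
    ring
  have hcd : ContDiff ℂ 1 Φ := by
    have hY : ∀ a, ContDiff ℂ 1 (fun z => Yc z a) := fun a =>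
      (contDiff_pi.1 Yc.contDiff) a
    refine contDiff_fst.prodMk (contDiff_pi.2 fun i => ?_)
    refine ((contDiff_pi.1 contDiff_snd) i).add (contDiff_const.mul ?_)
    exact ContDiff.sum fun a _ => ContDiff.sum fun b _ => (hY a).mul (contDiff_const.mul (hY b))
  have hd : HasFDerivAt Φ ((ContinuousLinearEquiv.refl ℂ (ℂ × (Fin 4 → ℂ)) :
      ℂ × (Fin 4 → ℂ) →L[ℂ] ℂ × (Fin 4 → ℂ))) 0 := by
    have hY : ∀ a, HasFDerivAt (fun z => Yc z a) ((ContinuousLinearMap.proj a).comp Yc) 0 := fun a =>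
      ((ContinuousLinearMap.proj (R := ℂ) (φ := fun _ : Fin 8 => ℂ) a).comp Yc).hasFDerivAt
    have h2 : HasFDerivAt (fun z : ℂ × (Fin 4 → ℂ) => fun i => z.2 i + (1/2) * ∑ a, ∑ b, Yc z a * (A i a b * Yc z b))
        (ContinuousLinearMap.snd ℂ ℂ (Fin 4 → ℂ)) 0 := by
      rw [hasFDerivAt_pi']
      intro i
      have hz : HasFDerivAt (fun z : ℂ × (Fin 4 → ℂ) => (1/2 : ℂ) * ∑ a, ∑ b, Yc z a * (A i a b * Yc z b))
          (0 : ℂ × (Fin 4 → ℂ) →L[ℂ] ℂ) 0 := by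
        have : ∀ a b, HasFDerivAt (fun z => Yc z a * (A i a b * Yc z b)) (0 : ℂ × (Fin 4 → ℂ) →L[ℂ] ℂ) 0 := by
          intro a b
          have := (hY a).mul ((hY b).const_mul (A i a b))
          exact this.congr_fderiv (ContinuousLinearMap.ext fun z => by simp)
        have h3 := (HasFDerivAt.fun_sum fun a (_ : a ∈ Finset.univ) => HasFDerivAt.fun_sum fun b (_ : b ∈ Finset.univ) => this a b).const_mul (1/2 : ℂ)
        exact h3.congr_fderiv (by simp)
      have h4 : HasFDerivAt (fun z : ℂ × (Fin 4 → ℂ) => z.2 i)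
          ((ContinuousLinearMap.proj i).comp (ContinuousLinearMap.snd ℂ ℂ (Fin 4 → ℂ))) 0 :=
        ((ContinuousLinearMap.proj (R := ℂ) (φ := fun _ : Fin 4 => ℂ) i).comp
          (ContinuousLinearMap.snd ℂ ℂ (Fin 4 → ℂ))).hasFDerivAt
      have := h4.add hz
      rw [add_zero] at this
      exact this
    exact (hasFDerivAt_fst (𝕜 := ℂ) (p := (0 : ℂ × (Fin 4 → ℂ)))).prodMk h2
  have hΦ0 : Φ 0 = 0 := by
    simp only [Φ, map_zero]
    ext <;> simp
  have h1 : (1 : WithTop ℕ∞) ≠ 0 := one_ne_zero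
  let hc := hcd.contDiffAt (x := (0 : ℂ × (Fin 4 → ℂ)))
  let Θ := hc.localInverse hd h1
  have hΘ : ContDiffAt ℂ 1 Θ 0 := by
    have := hc.to_localInverse hd h1
    rwa [hΦ0] at this
  have hΘ0 : Θ 0 = 0 := by
    have := hc.localInverse_apply_image hd h1
    rwa [hΦ0] at this
  have hst := hc.hasStrictFDerivAt' hd h1
  have hΘd : HasFDerivAt Θ ((ContinuousLinearEquiv.refl ℂ (ℂ × (Fin 4 → ℂ)) :
      ℂ × (Fin 4 → ℂ) →L[ℂ] ℂ × (Fin 4 → ℂ))) 0 := by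
    have := hst.to_localInverse.hasFDerivAt
    rwa [hΦ0] at this
  have hinv : ∀ᶠ y in 𝓝 (0 : ℂ × (Fin 4 → ℂ)), Φ (Θ y) = y := by
    have := hst.eventually_right_inverse
    rwa [hΦ0] at this
  let ι : ℂ → ℂ × (Fin 4 → ℂ) := fun t => (t, 0)
  have hι : HasDerivAt ι (1, 0) 0 := (hasDerivAt_id 0).prodMk (hasDerivAt_const 0 0)
  have hιc : ContDiff ℂ 1 ι := contDiff_id.prodMk contDiff_const
  have hι0 : ι 0 = 0 := rfl
  refine ⟨fun t => v + Yc (Θ (ι t)), ?_, ?_, ?_, ?_⟩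
  · refine contDiffAt_const.add (Yc.contDiff.contDiffAt.comp 0 ?_)
    exact ContDiffAt.comp (0 : ℂ) (by rw [hι0]; exact hΘ) hιc.contDiffAt
  · simp [hι0, hΘ0]
  · have a1 : HasDerivAt (fun t => Θ (ι t)) (1, 0) 0 :=
      HasFDerivAt.comp_hasDerivAt (l := Θ) (f := ι) (l' := (ContinuousLinearEquiv.refl ℂ (ℂ × (Fin 4 → ℂ)) :
        ℂ × (Fin 4 → ℂ) →L[ℂ] ℂ × (Fin 4 → ℂ))) (0 : ℂ) (by rw [hι0]; exact hΘd) hι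
    have a2 := (Yc.hasFDerivAt.comp_hasDerivAt (0 : ℂ) a1).const_add v
    have a3 : Yc (1, 0) = w := by
      change (1 : ℂ) • w + ∑ i, (0 : Fin 4 → ℂ) i • P i = w
      simp
    rw [a3] at a2
    exact a2
  · have : Tendsto ι (𝓝 0) (𝓝 0) := by
      have := hιc.continuous.tendsto 0
      rwa [hι0] at this
    filter_upwards [this.eventually hinv] with t ht i
    rw [hquad, ht]
    simp [ι]

lemma contDiffAt_det {E : Type*} [NormedAddCommGroup E] [NormedSpace ℂ E] (N : E → Matrix (Fin 4) (Fin 4) ℂ)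
    (x : E) (h : ∀ i j, ContDiffAt ℂ 1 (fun u => N u i j) x) : ContDiffAt ℂ 1 (fun u => (N u).det) x := by
  simp only [det_apply]
  refine ContDiffAt.sum fun σ _ => ?_
  refine ContDiffAt.const_smul _ ?_
  exact contDiffAt_prod fun i _ => h _ _

lemma local_coef (A : Fin 4 → M8) (v : V8)
    (hind : LinearIndependent ℂ (fun i => A i *ᵥ v)) (L : V8 → V8) (hL : ContDiff ℂ 1 L) :
    ∃ C : V8 → Fin 4 → ℂ, ContDiffAt ℂ 1 C v ∧
      ∀ᶠ u in 𝓝 v, ∀ y : Fin 4 → ℂ, L u = ∑ i, y i • A i *ᵥ u → y = C u := by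
  obtain ⟨P, hP⟩ := exists_dual _ hind
  let N : V8 → Matrix (Fin 4) (Fin 4) ℂ := fun u => Matrix.of fun i j => P i ⬝ᵥ A j *ᵥ u
  have hN : ∀ i j, ContDiffAt ℂ 1 (fun u => N u i j) v := by
    intro i j
    have : ContDiff ℂ 1 (fun u => N u i j) := by
      simp only [N, Matrix.of_apply, dotProduct, mulVec]
      exact ContDiff.sum fun a _ => contDiff_const.mul (ContDiff.sum fun b _ => contDiff_const.mul (contDiff_apply ℂ ℂ b))
    exact this.contDiffAt
  have hN1 : N v = 1 := by
    ext i j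
    simp [N, hP, Matrix.one_apply]
  let b : V8 → Fin 4 → ℂ := fun u i => P i ⬝ᵥ L u
  have hb : ∀ i, ContDiffAt ℂ 1 (fun u => b u i) v := by
    intro i
    have : ContDiff ℂ 1 (fun u => b u i) := by
      simp only [b, dotProduct]
      exact ContDiff.sum fun a _ => contDiff_const.mul (contDiff_pi.1 hL a)
    exact this.contDiffAt
  have hdet : ContDiffAt ℂ 1 (fun u => (N u).det) v := contDiffAt_det N v hN
  have hdv : (N v).det ≠ 0 := by rw [hN1]; simp
  refine ⟨fun u i => ((N u).updateCol i (b u)).det / (N u).det, ?_, ?_⟩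
  · rw [contDiffAt_pi]
    intro i
    refine ContDiffAt.div (contDiffAt_det _ v ?_) hdet hdv
    intro k j
    by_cases h : j = i
    · subst h; simpa using hb k
    · simpa [updateCol_ne h] using hN k j
  · filter_upwards [hdet.continuousAt.eventually_ne hdv] with u hu y hy
    have h1 : N u *ᵥ y = b u := by
      ext i
      simp only [b, hy, dotProduct_sum, dotProduct_smul, smul_eq_mul]
      simp only [mulVec, N, dotProduct, Matrix.of_apply]
      exact Finset.sum_congr rfl fun _ _ => mul_comm _ _
    ext i
    rw [eq_div_iff hu, ← cramer_apply, ← h1, cramer_eq_adjugate_mulVec, mulVec_mulVec, adjugate_mul]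
    simp [smul_mulVec, mul_comm]

structure GoodZ (A : Fin 4 → M8) (Z : Set V8) : Prop where
  ne0 : ∀ v ∈ Z, v ≠ 0
  inX : ∀ v ∈ Z, InX A v
  closed : IsClosed (Z ∩ Metric.sphere 0 1)
  cone : ∀ v ∈ Z, ∀ c : ℂ, c ≠ 0 → c • v ∈ Z
  curve : ∀ v ∈ Z, ∀ γ : ℂ → V8, ContDiffAt ℂ 1 γ 0 → γ 0 = v →
    (∀ᶠ t in 𝓝 0, InX A (γ t)) → ∀ᶠ t in 𝓝 0, γ t ∈ Z
  nonempty : Z.Nonempty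

lemma normalize_mem {A : Fin 4 → M8} {Z : Set V8} (hZ : GoodZ A Z) {v : V8} (hv : v ∈ Z) :
    ((‖v‖ : ℂ)⁻¹ • v) ∈ Z ∩ Metric.sphere 0 1 := by
  have h := hZ.ne0 v hv
  have h' : (‖v‖ : ℂ) ≠ 0 := by exact_mod_cast norm_ne_zero_iff.2 h
  refine ⟨hZ.cone v hv _ (inv_ne_zero h'), ?_⟩
  simp [norm_smul, h]

lemma coef_unique {A : Fin 4 → M8} {v : V8} (h : LinearIndependent ℂ (fun i => A i *ᵥ v))
    {x y : Fin 4 → ℂ} (hxy : ∑ i, x i • A i *ᵥ v = ∑ i, y i • A i *ᵥ v) : x = y :=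
  h.fintypeLinearCombination_injective (by simpa [Fintype.linearCombination_apply] using hxy)

lemma stage (A : Fin 4 → M8)
    (hsm : ∀ v, v ≠ 0 → InX A v → LinearIndependent ℂ (fun i => A i *ᵥ v))
    (Z : Set V8) (hZ : GoodZ A Z) {κ : Type} [Fintype κ] (L : κ → V8 → V8)
    (hL : ∀ k, ContDiff ℂ 1 (L k)) (hLs : ∀ k (t : ℂ) u, L k (t • u) = t • L k u)
    (hspan : ∀ k, ∀ u ∈ Z, ∃ c : Fin 4 → ℂ, L k u = ∑ i, c i • A i *ᵥ u) :
    ∃ Z' ⊆ Z, GoodZ A Z' ∧ ∃ c : κ → Fin 4 → ℂ, ∀ u ∈ Z', ∀ k, L k u = ∑ i, c k i • A i *ᵥ u := by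
  classical
  have hind : ∀ u ∈ Z, LinearIndependent ℂ (fun i => A i *ᵥ u) := fun u hu =>
    hsm u (hZ.ne0 u hu) (hZ.inX u hu)
  choose! c hc using hspan
  let h : V8 → EuclideanSpace ℂ (κ × Fin 4) := fun u => WithLp.toLp 2 fun p => c p.1 u p.2
  have hloc : ∀ v ∈ Z, ∃ H : V8 → EuclideanSpace ℂ (κ × Fin 4), ContDiffAt ℂ 1 H v ∧
      ∀ᶠ u in 𝓝 v, u ∈ Z → h u = H u := by
    intro v hv
    choose C hC1 hC2 using fun k => local_coef A v (hind v hv) (L k) (hL k)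
    refine ⟨fun u => WithLp.toLp 2 fun p => C p.1 u p.2, ?_, ?_⟩
    · rw [contDiffAt_piLp]
      intro p
      exact (contDiffAt_pi.1 (hC1 p.1)) p.2
    · filter_upwards [eventually_all.2 hC2] with u hu huZ
      simp only [h]
      congr 1
      funext p
      rw [hu p.1 _ (hc p.1 u huZ)]
  have hcont : ContinuousOn h Z := by
    intro v hv
    obtain ⟨H, hH1, hH2⟩ := hloc v hv
    refine hH1.continuousAt.continuousWithinAt.congr_of_eventuallyEq ?_ (hH2.self_of_nhds hv)
    exact eventually_nhdsWithin_iff.2 hH2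
  have hscale : ∀ v ∈ Z, ∀ t : ℂ, t ≠ 0 → h (t • v) = h v := by
    intro v hv t ht
    simp only [h]
    congr 1
    funext p
    have h1 := hc p.1 _ (hZ.cone v hv t ht)
    rw [hLs, hc p.1 v hv] at h1
    have : c p.1 v = c p.1 (t • v) := by
      apply coef_unique (hind v hv)
      simp only [mulVec_smul, smul_comm _ t, ← Finset.smul_sum] at h1
      exact smul_right_injective _ ht h1
    rw [this]
  have hK : IsCompact (Z ∩ Metric.sphere 0 1) :=
    (isCompact_sphere (0 : V8) 1).of_isClosed_subset hZ.closed Set.inter_subset_right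
  obtain ⟨z, hz⟩ := hZ.nonempty
  obtain ⟨v0, hv0, hmax⟩ := hK.exists_isMaxOn ⟨_, normalize_mem hZ hz⟩
    ((hcont.mono Set.inter_subset_left).norm)
  have hmax' : ∀ v ∈ Z, ‖h v‖ ≤ ‖h v0‖ := by
    intro v hv
    have := hmax (normalize_mem hZ hv)
    have h' : (‖v‖ : ℂ) ≠ 0 := by exact_mod_cast norm_ne_zero_iff.2 (hZ.ne0 v hv)
    simpa only [Set.mem_ofPred_eq, hscale v hv _ (inv_ne_zero h')] using this
  refine ⟨{v | v ∈ Z ∧ h v = h v0}, fun v hv => hv.1, ⟨fun v hv => hZ.ne0 v hv.1,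
    fun v hv => hZ.inX v hv.1, ?_, ?_, ?_, ⟨v0, hv0.1, rfl⟩⟩, fun k i => c k v0 i, ?_⟩
  · have := (hcont.mono (Set.inter_subset_left (t := Metric.sphere 0 1))).preimage_isClosed_of_isClosed
      hZ.closed (isClosed_singleton (x := h v0))
    convert this using 1
    ext v
    simp only [Set.mem_inter_iff, Set.mem_ofPred_eq, Set.mem_preimage, Set.mem_singleton_iff]
    tauto
  · intro v hv t ht
    exact ⟨hZ.cone v hv.1 t ht, (hscale v hv.1 t ht).trans hv.2⟩
  · rintro v ⟨hv, hvh⟩ γ hγ hγ0 hγX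
    have hγZ := hZ.curve v hv γ hγ hγ0 hγX
    obtain ⟨H, hH1, hH2⟩ := hloc v hv
    have hγt : Tendsto γ (𝓝 0) (𝓝 v) := by
      have := hγ.continuousAt.tendsto
      rwa [hγ0] at this
    have heq : ∀ᶠ t in 𝓝 0, h (γ t) = H (γ t) := by
      filter_upwards [hγZ, hγt.eventually hH2] with t h1 h2 using h2 h1
    have hcd : ContDiffAt ℂ 1 (fun t => h (γ t)) 0 := by
      refine ContDiffAt.congr_of_eventuallyEq ?_ heq
      exact ContDiffAt.comp (0 : ℂ) (by rw [hγ0]; exact hH1) hγ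
    have hdiff : ∀ᶠ t in 𝓝 (0 : ℂ), DifferentiableAt ℂ (fun t => h (γ t)) t := by
      filter_upwards [hcd.eventually (by simp)] with t ht
      exact ht.differentiableAt (by simp)
    have hlm : IsLocalMax (norm ∘ fun t => h (γ t)) 0 := by
      filter_upwards [hγZ] with t ht
      simp only [Function.comp, hγ0, hvh]
      exact hmax' _ ht
    have := Complex.eventually_eq_of_isLocalMax_norm hdiff hlm
    filter_upwards [this, hγZ] with t h1 h2
    refine ⟨h2, ?_⟩
    rw [h1, hγ0, hvh]
  · rintro u ⟨hu, huh⟩ k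
    rw [hc k u hu]
    refine Finset.sum_congr rfl fun i _ => ?_
    have := congrArg (fun x : EuclideanSpace ℂ (κ × Fin 4) => x (k, i)) huh
    simp only [h] at this
    rw [this]

lemma dot_curve (l : V8) (γ : ℂ → V8) (w : V8) (h : HasDerivAt γ w 0) (hz : ∀ᶠ t in 𝓝 0, l ⬝ᵥ γ t = 0) :
    l ⬝ᵥ w = 0 := by
  have h1 : HasDerivAt (fun t => l ⬝ᵥ γ t) (l ⬝ᵥ w) 0 := by
    simp only [dotProduct]
    exact HasDerivAt.fun_sum fun i _ => ((hasDerivAt_pi.1 h) i).const_mul _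
  have h2 : HasDerivAt (fun t => l ⬝ᵥ γ t) 0 0 :=
    (hasDerivAt_const (0 : ℂ) (0 : ℂ)).congr_of_eventuallyEq hz
  exact h1.unique h2

lemma quad_curve (F : M8) (hF : F.IsSymm) (γ : ℂ → V8) (w : V8) (h : HasDerivAt γ w 0)
    (hz : ∀ᶠ t in 𝓝 0, γ t ⬝ᵥ F *ᵥ γ t = 0) : (F *ᵥ γ 0) ⬝ᵥ w = 0 := by
  have h0 : HasDerivAt (fun t => F *ᵥ γ t) (F *ᵥ w) 0 := by
    rw [hasDerivAt_pi]
    intro a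
    simp only [mulVec, dotProduct]
    exact HasDerivAt.fun_sum fun i _ => ((hasDerivAt_pi.1 h) i).const_mul _
  have h1 : HasDerivAt (fun t => γ t ⬝ᵥ F *ᵥ γ t) (w ⬝ᵥ F *ᵥ γ 0 + γ 0 ⬝ᵥ F *ᵥ w) 0 := by
    simp only [dotProduct, ← Finset.sum_add_distrib]
    exact HasDerivAt.fun_sum fun i _ => ((hasDerivAt_pi.1 h) i).mul ((hasDerivAt_pi.1 h0) i)
  have h2 : HasDerivAt (fun t => γ t ⬝ᵥ F *ᵥ γ t) 0 0 :=
    (hasDerivAt_const (0 : ℂ) (0 : ℂ)).congr_of_eventuallyEq hz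
  have h3 := h1.unique h2
  have e2 : γ 0 ⬝ᵥ F *ᵥ w = (F *ᵥ γ 0) ⬝ᵥ w := by
    rw [dotProduct_mulVec, ← mulVec_transpose, hF.eq]
  rw [e2, dotProduct_comm w] at h3
  linear_combination h3 / 2

lemma exists_tangent (a : Fin 4 → V8) (v : V8) :
    ∃ w, (∀ i, a i ⬝ᵥ w = 0) ∧ w ∉ Submodule.span ℂ {v} := by
  by_contra hcon
  push Not at hcon
  let T : V8 →ₗ[ℂ] (Fin 4 → ℂ) := (Matrix.of a).mulVecLin
  have h1 := T.finrank_range_add_finrank_ker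
  have h2 : Module.finrank ℂ (LinearMap.range T) ≤ 4 := by
    simpa using Submodule.finrank_le (LinearMap.range T)
  have h3 : LinearMap.ker T ≤ Submodule.span ℂ {v} := by
    intro w hw
    apply hcon
    intro i
    exact congrFun (LinearMap.mem_ker.1 hw) i
  have h4 := (Submodule.finrank_mono h3).trans (finrank_span_le_card ({v} : Set V8))
  rw [Module.finrank_fin_fun] at h1
  simp only [Set.toFinset_singleton, Finset.card_singleton] at h4
  omega

theorem quadric_mem_span (A : Fin 4 → M8) (hA : ∀ i, (A i).IsSymm)
    (hsm : ∀ v, v ≠ 0 → InX A v → LinearIndependent ℂ (fun i => A i *ᵥ v))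
    (hne : ∃ v, v ≠ 0 ∧ InX A v)
    (F : M8) (hF : F.IsSymm) (hFX : ∀ v, InX A v → v ⬝ᵥ F *ᵥ v = 0) :
    F ∈ Submodule.span ℂ (Set.range A) := by
  have hcl : IsClosed {v | InX A v} := by
    have : {v | InX A v} = ⋂ i, {v : V8 | v ⬝ᵥ A i *ᵥ v = 0} := by
      ext v; simp [InX]
    rw [this]
    exact isClosed_iInter fun i => isClosed_eq (by fun_prop) continuous_const
  have hZ0 : GoodZ A {v | v ≠ 0 ∧ InX A v} := by
    refine ⟨fun v hv => hv.1, fun v hv => hv.2, ?_, ?_, ?_, hne⟩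
    · convert hcl.inter (Metric.isClosed_sphere (x := (0 : V8)) (ε := 1)) using 1
      ext v
      simp only [Set.mem_inter_iff, Set.mem_ofPred_eq, mem_sphere_zero_iff_norm]
      constructor
      · rintro ⟨⟨_, h⟩, h'⟩; exact ⟨h, h'⟩
      · rintro ⟨h, h'⟩
        refine ⟨⟨?_, h⟩, h'⟩
        rintro rfl
        simp at h'
    · rintro v ⟨hv, hvX⟩ c hc
      refine ⟨smul_ne_zero hc hv, fun i => ?_⟩
      rw [mulVec_smul, dotProduct_smul, smul_dotProduct, hvX i]
      simp
    · rintro v ⟨hv, hvX⟩ γ hγ hγ0 hγX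
      have := hγ.continuousAt.eventually_ne (by rw [hγ0]; exact hv)
      filter_upwards [this, hγX] with t h1 h2 using ⟨h1, h2⟩
  obtain ⟨Z1, -, hZ1, c1, hc1⟩ := stage A hsm _ hZ0 (κ := Unit) (fun _ u => F *ᵥ u)
    (fun _ => (LinearMap.toContinuousLinearMap F.mulVecLin).contDiff)
    (fun _ t u => mulVec_smul _ _ _) (by
      rintro - u ⟨hu, huX⟩
      apply mem_span_of_ker _ (hsm u hu huX)
      intro w hw
      obtain ⟨γ, hγ, hγ0, hγd, hγX⟩ := exists_curve A hA u huX (hsm u hu huX) w hw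
      have := quad_curve F hF γ w hγd (hγX.mono fun t ht => hFX _ ht)
      rwa [hγ0] at this)
  set F' : M8 := F - ∑ i, c1 () i • A i with hF'
  have hF'0 : ∀ u ∈ Z1, F' *ᵥ u = 0 := by
    intro u hu
    have := hc1 u hu ()
    rw [hF', sub_mulVec, this, sum_mulVec, sub_eq_zero]
    simp only [smul_mulVec]
  by_cases hz : F' = 0
  · rw [hF', sub_eq_zero] at hz
    rw [hz]
    exact Submodule.sum_mem _ fun i _ => Submodule.smul_mem _ _ (Submodule.subset_span ⟨i, rfl⟩)
  exfalso
  obtain ⟨r, hr⟩ : ∃ r, F' r ≠ 0 := by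
    by_contra hcon
    push Not at hcon
    exact hz (funext hcon)
  set l : V8 := F' r with hl
  have hlZ : ∀ u ∈ Z1, l ⬝ᵥ u = 0 := fun u hu => congrFun (hF'0 u hu) r
  have hlspan : ∀ u ∈ Z1, ∃ c : Fin 4 → ℂ, l = ∑ i, c i • A i *ᵥ u := by
    intro u hu
    have hind := hsm u (hZ1.ne0 u hu) (hZ1.inX u hu)
    apply mem_span_of_ker _ hind
    intro w hw
    obtain ⟨γ, hγ, hγ0, hγd, hγX⟩ := exists_curve A hA u (hZ1.inX u hu) hind w hw
    exact dot_curve l γ w hγd ((hZ1.curve u hu γ hγ hγ0 hγX).mono fun t ht => hlZ _ ht)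
  obtain ⟨Z2, hZ21, hZ2, c2, hc2⟩ := stage A hsm Z1 hZ1 (κ := Fin 8) (fun j u => u j • l)
    (fun j => (contDiff_apply ℂ ℂ j).smul contDiff_const)
    (fun j t u => by simp [smul_smul]) (by
      intro j u hu
      obtain ⟨c, hc⟩ := hlspan u hu
      refine ⟨fun i => u j * c i, ?_⟩
      conv_lhs => rw [hc]
      rw [Finset.smul_sum]
      simp only [smul_smul])
  have hrank : ∀ u ∈ Z2, ∃ b : Fin 4 → ℂ, l = ∑ i, b i • A i *ᵥ u ∧ ∀ j i, c2 j i = u j * b i := by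
    intro u hu
    obtain ⟨b, hb⟩ := hlspan u (hZ21 hu)
    refine ⟨b, hb, fun j i => ?_⟩
    have h1 := hc2 u hu j
    rw [hb, Finset.smul_sum] at h1
    simp only [smul_smul] at h1
    exact (congrFun (coef_unique (hsm u (hZ2.ne0 u hu) (hZ2.inX u hu)) h1) i).symm
  obtain ⟨v, hv⟩ := hZ2.nonempty
  obtain ⟨b, hb, hbc⟩ := hrank v hv
  obtain ⟨i, hi⟩ : ∃ i, b i ≠ 0 := by
    by_contra hcon
    push Not at hcon
    apply hr
    rw [hb]
    simp [hcon]
  have hline : ∀ u ∈ Z2, u ∈ Submodule.span ℂ {v} := by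
    intro u hu
    obtain ⟨b', -, hb'⟩ := hrank u hu
    have h1 : b' i • u = b i • v := by
      ext j
      simp only [Pi.smul_apply, smul_eq_mul]
      rw [mul_comm, ← hb', hbc, mul_comm]
    have h2 : b' i ≠ 0 := by
      intro h0
      rw [h0, zero_smul] at h1
      exact smul_ne_zero hi (hZ2.ne0 v hv) h1.symm
    rw [Submodule.mem_span_singleton]
    refine ⟨(b' i)⁻¹ * b i, ?_⟩
    rw [mul_smul, ← h1, smul_smul, inv_mul_cancel₀ h2, one_smul]
  obtain ⟨w, hw, hwv⟩ := exists_tangent (fun i => A i *ᵥ v) v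
  obtain ⟨γ, hγ, hγ0, hγd, hγX⟩ := exists_curve A hA v (hZ2.inX v hv)
    (hsm v (hZ2.ne0 v hv) (hZ2.inX v hv)) w hw
  have hγZ := hZ2.curve v hv γ hγ hγ0 hγX
  apply hwv
  have hclosed : IsClosed ((Submodule.span ℂ {v} : Submodule ℂ V8) : Set V8) :=
    Submodule.closed_of_finiteDimensional _
  have hslope := hasDerivAt_iff_tendsto_slope.1 hγd
  refine hclosed.mem_of_tendsto hslope ?_
  filter_upwards [eventually_nhdsWithin_of_eventually_nhds hγZ] with t ht
  rw [slope_def_module, hγ0]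
  exact Submodule.smul_mem _ _ (Submodule.sub_mem _ (hline _ ht) (Submodule.mem_span_singleton_self v))

lemma sum_finrank_le {K W : Type*} [Field K] [AddCommGroup W] [Module K W] [FiniteDimensional K W]
    {ι : Type*} (N : ι → Submodule K W) (h : iSupIndep N) (s : Finset ι) :
    ∑ i ∈ s, Module.finrank K (N i) ≤ Module.finrank K W := by
  classical
  have h' : iSupIndep (fun i : s => N i) := h.comp Subtype.val_injective
  have hinj := h'.dfinsupp_lsum_injective
  have := LinearMap.finrank_le_finrank_of_injective hinj
  rw [← Finset.sum_coe_sort]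
  refine le_trans (le_of_eq ?_) this
  exact (Module.finrank_directSum (R := K) (fun i : s => N i)).symm

lemma trace_formula (f : Module.End ℂ V8) (hf : ⨆ μ : ℂ, f.eigenspace μ = ⊤) (s : Finset ℂ)
    (hs : ∀ μ, f.eigenspace μ ≠ ⊥ → μ ∈ s) :
    LinearMap.trace ℂ V8 f = ∑ μ ∈ s, μ * (Module.finrank ℂ (f.eigenspace μ) : ℂ) ∧
    8 = ∑ μ ∈ s, Module.finrank ℂ (f.eigenspace μ) := by
  classical
  have hds := DirectSum.isInternal_submodule_of_iSupIndep_of_iSup_eq_top f.eigenspaces_iSupIndep hf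
  have hfin : {μ | f.eigenspace μ ≠ ⊥}.Finite :=
      WellFoundedGT.finite_ne_bot_of_iSupIndep f.eigenspaces_iSupIndep
  have hsub : hfin.toFinset ⊆ s := fun μ hμ => hs μ (by simpa using hμ)
  have hzero : ∀ μ ∈ s, μ ∉ hfin.toFinset → Module.finrank ℂ (f.eigenspace μ) = 0 := by
    intro μ _ hμ
    have : f.eigenspace μ = ⊥ := by simpa using hμ
    rw [this, finrank_bot]
  have hm : ∀ μ, Set.MapsTo f (f.eigenspace μ) (f.eigenspace μ) := by
    intro μ v hv
    have hv' : f v = μ • v := Module.End.mem_eigenspace_iff.1 hv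
    rw [hv']
    exact Submodule.smul_mem _ _ hv
  constructor
  · rw [LinearMap.trace_eq_sum_trace_restrict' hds hfin hm]
    rw [← Finset.sum_subset hsub (fun μ h1 h2 => by rw [hzero μ h1 h2]; simp)]
    refine Finset.sum_congr rfl fun μ _ => ?_
    have : f.restrict (hm μ) = μ • LinearMap.id := by
      ext1 v
      apply Subtype.ext
      exact Module.End.mem_eigenspace_iff.1 v.2
    rw [this, map_smul, LinearMap.trace_id, smul_eq_mul]
  · rw [← Finset.sum_subset hsub (fun μ h1 h2 => hzero μ h1 h2)]
    have := LinearMap.trace_eq_sum_trace_restrict' hds hfin (f := LinearMap.id) (fun μ v hv => hv)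
    have h2 : ∀ μ, (LinearMap.id : V8 →ₗ[ℂ] V8).restrict (p := f.eigenspace μ) (q := f.eigenspace μ)
      (fun v hv => hv) = LinearMap.id := fun μ => rfl
    simp only [h2, LinearMap.trace_id, Module.finrank_fin_fun] at this
    exact_mod_cast this

lemma trace_zero_of_le (f : Module.End ℂ V8) (hf : ⨆ μ : ℂ, f.eigenspace μ = ⊤)
    {W : Type*} [AddCommGroup W] [Module ℂ W] [FiniteDimensional ℂ W]
    (hW : Module.finrank ℂ W ≤ 4) (T : Module.End ℂ W)
    (h : ∀ μ : ℂ, Module.finrank ℂ (f.eigenspace μ) ≤ Module.finrank ℂ (T.eigenspace (μ ^ 2))) :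
    LinearMap.trace ℂ V8 f = 0 := by
  classical
  have hfin : {μ | f.eigenspace μ ≠ ⊥}.Finite :=
      WellFoundedGT.finite_ne_bot_of_iSupIndep f.eigenspaces_iSupIndep
  let s : Finset ℂ := hfin.toFinset ∪ hfin.toFinset.image (fun x => -x)
  have hneg : ∀ μ ∈ s, -μ ∈ s := by
    intro μ hμ
    simp only [s, Finset.mem_union, Finset.mem_image] at hμ ⊢
    rcases hμ with h | ⟨a, h, rfl⟩
    · exact Or.inr ⟨μ, h, rfl⟩
    · left; simpa using h
  obtain ⟨htr, h8⟩ := trace_formula f hf s (fun μ hμ => by simp [s, hμ])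
  have hle : ∑ μ ∈ s, Module.finrank ℂ (T.eigenspace (μ ^ 2)) ≤ 8 := by
    rw [Finset.sum_comp (fun x => Module.finrank ℂ (T.eigenspace x)) (fun μ : ℂ => μ ^ 2)]
    calc _ ≤ ∑ x ∈ s.image (fun μ => μ ^ 2), 2 * Module.finrank ℂ (T.eigenspace x) := by
          refine Finset.sum_le_sum fun x hx => ?_
          rw [smul_eq_mul]
          refine Nat.mul_le_mul_right _ ?_
          obtain ⟨y, hy, rfl⟩ := Finset.mem_image.1 hx
          refine (Finset.card_le_card (t := {y, -y}) ?_).trans Finset.card_le_two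
          intro z hz
          have := (Finset.mem_filter.1 hz).2
          simpa using sq_eq_sq_iff_eq_or_eq_neg.1 this
      _ = 2 * ∑ x ∈ s.image (fun μ => μ ^ 2), Module.finrank ℂ (T.eigenspace x) := by
          rw [Finset.mul_sum]
      _ ≤ 8 := by
          have := sum_finrank_le _ T.eigenspaces_iSupIndep (s.image (fun μ => μ ^ 2))
          omega
  have heq := (Finset.sum_eq_sum_iff_of_le (s := s) (fun μ _ => h μ)).1
    (le_antisymm (Finset.sum_le_sum fun μ _ => h μ) (hle.trans h8.le))
  have hsym : ∀ μ ∈ s, Module.finrank ℂ (f.eigenspace (-μ)) = Module.finrank ℂ (f.eigenspace μ) := by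
    intro μ hμ
    rw [heq μ hμ, heq (-μ) (hneg μ hμ), neg_sq]
  have h2 : ∑ μ ∈ s, μ * (Module.finrank ℂ (f.eigenspace μ) : ℂ) =
      ∑ μ ∈ s, -(μ * (Module.finrank ℂ (f.eigenspace μ) : ℂ)) := by
    refine Finset.sum_nbij' (fun μ => -μ) (fun μ => -μ) hneg hneg (by simp) (by simp) ?_
    intro μ hμ
    rw [hsym μ hμ]; ring
  rw [Finset.sum_neg_distrib, ← htr] at h2
  exact self_eq_neg.1 h2

lemma eigen_top (f : Module.End ℂ V8) (n : ℕ) (hn : n ≠ 0) (h : f ^ n = 1) :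
    ⨆ μ : ℂ, f.eigenspace μ = ⊤ := by
  apply Module.End.IsSemisimple.iSup_eigenspace_eq_top
  have hsep : (Polynomial.X ^ n - 1 : Polynomial ℂ).Separable :=
    Polynomial.X_pow_sub_one_separable_iff.2 (by exact_mod_cast hn)
  apply Module.End.isSemisimple_of_squarefree_aeval_eq_zero hsep.squarefree
  simp [h]

lemma trace_zero (A : Fin 4 → M8) (hA : ∀ i, (A i).IsSymm)
    (hsm : ∀ v, v ≠ 0 → InX A v → LinearIndependent ℂ (fun i => A i *ᵥ v))
    (f : Module.End ℂ V8) (n : ℕ) (hn : n ≠ 0) (hfn : f ^ n = 1)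
    (hpres : ∀ v, InX A v → InX A (f v))
    (hfree : ∀ v, v ≠ 0 → InX A v → ¬ ∃ c : ℂ, f v = c • v) : LinearMap.trace ℂ V8 f = 0 := by
  classical
  have hne : ∃ v, v ≠ 0 ∧ InX A v := by
    by_contra hcon
    push Not at hcon
    have := dimA' (⊤ : Submodule ℂ V8) A (fun v _ hv => by
      by_contra h0
      exact hcon v h0 hv)
    rw [finrank_top, Module.finrank_fin_fun] at this
    omega
  let g : M8 := LinearMap.toMatrix' f
  have hg : ∀ v, g *ᵥ v = f v := fun v => LinearMap.toMatrix'_mulVec f v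
  let Q : Submodule ℂ M8 := Submodule.span ℂ (Set.range A)
  let TT : M8 →ₗ[ℂ] M8 := (LinearMap.mulRight ℂ g).comp (LinearMap.mulLeft ℂ gᵀ)
  have hTT : ∀ F v, v ⬝ᵥ TT F *ᵥ v = f v ⬝ᵥ F *ᵥ f v := by
    intro F v
    change v ⬝ᵥ (gᵀ * F * g) *ᵥ v = _
    rw [← mulVec_mulVec, ← mulVec_mulVec, hg, mulVec_transpose, dotProduct_comm,
      ← dotProduct_mulVec, hg, dotProduct_comm]
  have hmaps : ∀ F ∈ Q, TT F ∈ Q := by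
    intro F hF
    have : Q ≤ Q.comap TT := by
      refine Submodule.span_le.2 ?_
      rintro _ ⟨i, rfl⟩
      refine quadric_mem_span A hA hsm hne _ ?_ ?_
      · change (gᵀ * A i * g)ᵀ = gᵀ * A i * g
        rw [transpose_mul, transpose_mul, transpose_transpose, (hA i).eq, Matrix.mul_assoc]
      · intro v hv
        rw [hTT]
        exact hpres v hv i
    exact this hF
  let T : Module.End ℂ Q := TT.restrict hmaps
  have hQ : Module.finrank ℂ Q ≤ 4 := by
    have h := finrank_range_le_card (R := ℂ) A
    rw [Fintype.card_fin] at h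
    exact h
  refine trace_zero_of_le f (eigen_top f n hn hfn) hQ T ?_
  intro μ
  let D : Module.End ℂ Q := T - algebraMap ℂ _ (μ ^ 2)
  have hD : T.eigenspace (μ ^ 2) = LinearMap.ker D := Module.End.eigenspace_def
  obtain ⟨C, hC⟩ := Submodule.exists_isCompl (LinearMap.range D)
  have hfr : Module.finrank ℂ C = Module.finrank ℂ (T.eigenspace (μ ^ 2)) := by
    rw [hD]
    have h1 := Submodule.finrank_add_eq_of_isCompl hC
    have h2 := D.finrank_range_add_finrank_ker
    omega
  rw [← hfr]
  have : Module.Free ℂ C := Module.Free.of_divisionRing ℂ C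
  let b := Module.finBasis ℂ C
  apply dimA' (f.eigenspace μ) (fun j => ((b j : Q) : M8))
  intro v hv hb
  have hv' : f v = μ • v := Module.End.mem_eigenspace_iff.1 hv
  -- the evaluation functional on `Q`
  let ev : Q →ₗ[ℂ] ℂ :=
    { toFun := fun F => v ⬝ᵥ (F : M8) *ᵥ v
      map_add' := fun x y => by simp [add_mulVec]
      map_smul' := fun c x => by simp [smul_mulVec] }
  have hev1 : LinearMap.range D ≤ LinearMap.ker ev := by
    rintro _ ⟨F, rfl⟩
    rw [LinearMap.mem_ker]
    have : D F = T F - (μ ^ 2) • F := rfl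
    rw [this, map_sub, map_smul]
    change v ⬝ᵥ TT F *ᵥ v - (μ ^ 2) • (v ⬝ᵥ (F : M8) *ᵥ v) = 0
    rw [hTT, hv', mulVec_smul, dotProduct_smul, smul_dotProduct]
    simp only [smul_eq_mul]
    ring
  have hev2 : C ≤ LinearMap.ker ev := by
    have : ev.comp C.subtype = 0 := b.ext fun j => hb j
    intro x hx
    exact LinearMap.congr_fun this ⟨x, hx⟩
  have htop : LinearMap.ker ev = ⊤ := by
    rw [eq_top_iff, ← hC.sup_eq_top]
    exact sup_le hev1 hev2
  have hvX : InX A v := fun i => by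
    have : (⟨A i, Submodule.subset_span ⟨i, rfl⟩⟩ : Q) ∈ LinearMap.ker ev := by rw [htop]; trivial
    exact this
  by_contra h0
  exact hfree v h0 hvX ⟨μ, hv'⟩

theorem card_dvd_eight_of_free_linear_action_on_quadric_ci
    (q : Fin 4 → MvPolynomial (Fin 8) ℂ)
    (hhom : ∀ i, (q i).IsHomogeneous 2)
    (hsmooth : ∀ v : V8, v ≠ 0 → (∀ i, eval v (q i) = 0) →
      (Matrix.of fun (i : Fin 4) (j : Fin 8) => eval v (pderiv j (q i))).rank = 4)
    (G : Subgroup GL8) [Finite G]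
    (hpres : ∀ g ∈ G, ∀ v : V8, (∀ i, eval v (q i) = 0) → ∀ i, eval (g v) (q i) = 0)
    (hfree : ∀ g ∈ G, g ≠ 1 →
      ∀ v : V8, v ≠ 0 → (∀ i, eval v (q i) = 0) → ¬ ∃ c : ℂ, g v = c • v) :
    Nat.card G ∣ 8 := by
  classical
  choose A hA hder hval using fun i => polyMat (q i) (hhom i)
  have hX : ∀ v, InX A v ↔ ∀ i, eval v (q i) = 0 := by
    intro v
    refine forall_congr' fun i => ?_
    rw [← hval]
    simp
  have hsm : ∀ v, v ≠ 0 → InX A v → LinearIndependent ℂ (fun i => A i *ᵥ v) := by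
    intro v hv hvX
    have h1 := hsmooth v hv ((hX v).1 hvX)
    have h2 : (Matrix.of fun (i : Fin 4) (j : Fin 8) => eval v (pderiv j (q i))) =
        Matrix.of fun i => A i *ᵥ v := by
      ext i j
      simp [hder]
    rw [h2, Matrix.rank_eq_finrank_span_row] at h1
    exact linearIndependent_iff_card_eq_finrank_span.2 (by rw [Fintype.card_fin]; exact h1.symm)
  have : Fintype G := Fintype.ofFinite G
  let ρ : Representation ℂ G V8 :=
    (LinearEquiv.automorphismGroup.toLinearMapMonoidHom (R := ℂ) (M := V8)).comp G.subtype
  have hcard : (Nat.card G : ℂ) ≠ 0 := by exact_mod_cast Nat.card_pos.ne'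
  have : Invertible (Nat.card G : ℂ) := invertibleOfNonzero hcard
  have hav := Representation.card_inv_mul_sum_char_eq_finrank (ρ := ρ)
  have hchar : ∀ g : G, g ≠ 1 → ρ.character g = 0 := by
    intro g hg
    refine trace_zero A hA hsm (ρ g) (Nat.card G) Nat.card_pos.ne' ?_ ?_ ?_
    · rw [← map_pow, pow_card_eq_one', map_one]
    · intro v hv
      rw [hX] at hv ⊢
      exact hpres g g.2 v hv
    · intro v hv0 hv
      rw [hX] at hv
      exact hfree g g.2 (by simpa using hg) v hv0 hv
  rw [Finset.sum_eq_single (1 : G) (fun g _ hg => hchar g hg) (by simp),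
    Representation.char_one, Module.finrank_fin_fun, inv_mul_eq_iff_eq_mul₀ hcard] at hav
  exact ⟨_, by exact_mod_cast hav⟩
end

section
/- There is no group H of order 128 all of whose subgroups of order 64 are isomorphic to one of the five groups with GAP IDs (64,2), (64,3), (64,68), (64,72), (64,179), i.e., to ℤ/8 × ℤ/8, the semidirect products ℤ/8 ⋊ ℤ/8 with GAP IDs (64,3), (64,68), (64,72), or ℤ/8 ⋊ Q8 with GAP ID (64,179). -/
/-- The monomial transformation `(x_i) ↦ (c_i · x_{e i})`. -/
noncomputable def monomial (c : Fin 8 → ℂˣ) (e : Equiv.Perm (Fin 8)) : GL8 :=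
  (LinearEquiv.funCongrLeft ℂ ℂ e).trans
    (LinearEquiv.piCongrRight fun i => LinearEquiv.smulOfUnit (c i))

/-- `PGL(8, ℂ) = GL(8, ℂ)/center`. -/
abbrev PGL8 := GL8 ⧸ Subgroup.center GL8

noncomputable def mk8 (c : Fin 8 → ℂˣ) (e : Equiv.Perm (Fin 8)) : PGL8 :=
  QuotientGroup.mk (monomial c e)

/-- The involution `0↔6, 1↔7, 2↔4, 3↔5` of `Fin 8`. -/
def eA : Equiv.Perm (Fin 8) :=
  ⟨![6, 7, 4, 5, 2, 3, 0, 1], ![6, 7, 4, 5, 2, 3, 0, 1],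
    by intro x; fin_cases x <;> rfl, by intro x; fin_cases x <;> rfl⟩

/-- The involution `0↔1, 2↔3, 4↔5, 6↔7` of `Fin 8`. -/
def eB : Equiv.Perm (Fin 8) :=
  ⟨![1, 0, 3, 2, 5, 4, 7, 6], ![1, 0, 3, 2, 5, 4, 7, 6],
    by intro x; fin_cases x <;> rfl, by intro x; fin_cases x <;> rfl⟩

/-- The involution `0↔4, 1↔5, 2↔6, 3↔7` of `Fin 8`. -/
def eC : Equiv.Perm (Fin 8) :=
  ⟨![4, 5, 6, 7, 0, 1, 2, 3], ![4, 5, 6, 7, 0, 1, 2, 3],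
    by intro x; fin_cases x <;> rfl, by intro x; fin_cases x <;> rfl⟩

/-- The involution `0↔5, 1↔4, 2↔7, 3↔6` of `Fin 8`. -/
def eD : Equiv.Perm (Fin 8) :=
  ⟨![5, 4, 7, 6, 1, 0, 3, 2], ![5, 4, 7, 6, 1, 0, 3, 2],
    by intro x; fin_cases x <;> rfl, by intro x; fin_cases x <;> rfl⟩

/-- The imaginary unit as a unit of `ℂ`. -/
noncomputable def Iu : ℂˣ := Units.mk0 Complex.I Complex.I_ne_zero


/-! ### Multiplication tables of the five groups, on codes `0, …, 63` -/

/-- Multiplication of `ℤ/8 ⋊ ℤ/8`, the action being by `1 + 4 * ε`. -/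
def mul12 (ε x y : ℕ) : ℕ :=
  8 * ((x / 8 + y / 8 * (1 + 4 * ε * (x % 8))) % 8) + (x % 8 + y % 8) % 8

/-- Multiplication of `ℤ/8 ⋊ Q₈`; the code of `τ^i ρ^j σ^k` is `16 * j + 8 * k + i`. -/
def mul3 (x y : ℕ) : ℕ :=
  16 * ((x / 16 + (y / 16) * (1 + 2 * (x / 8 % 2)) + 2 * ((x / 8 % 2) * (y / 8 % 2))) % 4)
    + 8 * ((x / 8 + y / 8) % 2) + (x % 8 + y % 8 * (1 + 2 * (x / 8 % 2))) % 8

/-- The cocycle of `G₄`. -/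
def beta4 (v u : ℕ) : ℕ :=
  ((v % 2) * ((u % 2) * 3)) ^^^
  ((v / 2 % 2) * (((u % 2) * 2) ^^^ ((u / 2 % 2) * 2))) ^^^
  ((v / 4) * (((u / 2 % 2) * 7) ^^^ ((u / 4) * 2)))

/-- The cocycle of `G₅`. -/
def beta5 (v u : ℕ) : ℕ :=
  ((v % 2) * ((u % 2) * 2)) ^^^
  ((v / 2 % 2) * (((u % 2) * 2) ^^^ ((u / 2 % 2) * 4))) ^^^
  ((v / 4) * (((u % 2) * 2) ^^^ ((u / 2 % 2) * 7) ^^^ ((u / 4) * 2)))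

def mul45 (β : ℕ → ℕ → ℕ) (x y : ℕ) : ℕ :=
  8 * ((x / 8) ^^^ (y / 8)) + ((x % 8) ^^^ (y % 8) ^^^ β (x / 8) (y / 8))

def p2 (m : ℕ → ℕ → ℕ) (x : ℕ) : ℕ := m x x
def p4 (m : ℕ → ℕ → ℕ) (x : ℕ) : ℕ := p2 m (p2 m x)
def iv (m : ℕ → ℕ → ℕ) (x : ℕ) : ℕ := m x (m (p2 m x) (p4 m x))

/-- `r` identifies the codes `0, …, 63` with multiplication `m` with the subgroup `K`. -/
structure IsModelBy {H : Type*} [Group H] (m : ℕ → ℕ → ℕ) (K : Subgroup H) (r : ℕ → H) :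
    Prop where
  mem : ∀ x < 64, r x ∈ K
  surj : ∀ k ∈ K, ∃ x < 64, r x = k
  inj : ∀ x < 64, ∀ y < 64, r x = r y → x = y
  lt : ∀ x < 64, ∀ y < 64, m x y < 64
  mul : ∀ x < 64, ∀ y < 64, r (m x y) = r x * r y

/-- A finite nonempty set closed under multiplication. -/
theorem closure_subset_image {G : Type*} [Group G] (m : ℕ → ℕ → ℕ) (r : ℕ → G)
    (lt : ∀ x < 64, ∀ y < 64, m x y < 64)
    (mul : ∀ x < 64, ∀ y < 64, r (m x y) = r x * r y)
    (S : Set G) (hS : ∀ s ∈ S, ∃ x < 64, r x = s) :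
    ∀ g ∈ Subgroup.closure S, ∃ x < 64, r x = g := by
  have hfin : (r '' {x | x < 64}).Finite := (Set.finite_lt_nat 64).image r
  have hmul : ∀ a b : G, a ∈ r '' {x | x < 64} → b ∈ r '' {x | x < 64} →
      a * b ∈ r '' {x | x < 64} := by
    rintro _ _ ⟨x, hx, rfl⟩ ⟨y, hy, rfl⟩
    exact ⟨m x y, lt x hx y hy, mul x hx y hy⟩
  have hpow : ∀ a : G, a ∈ r '' {x | x < 64} → ∀ n : ℕ, a ^ (n + 1) ∈ r '' {x | x < 64} := by
    intro a ha n
    induction n with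
    | zero => simpa using ha
    | succ n ih => rw [pow_succ]; exact hmul _ _ ih ha
  have hfo : ∀ a : G, a ∈ r '' {x | x < 64} → IsOfFinOrder a := by
    intro a ha
    by_contra h
    have hinj : Function.Injective (fun n : ℕ => a ^ n) :=
      injective_pow_iff_not_isOfFinOrder.2 h
    have : (Set.range fun n : ℕ => a ^ (n + 1)).Infinite := by
      apply Set.infinite_range_of_injective
      intro i j hij
      have := hinj hij
      omega
    refine this (hfin.subset ?_)
    rintro _ ⟨n, rfl⟩
    exact hpow a ha n
  have hone : (1 : G) ∈ r '' {x | x < 64} := by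
    have h0 : r 0 ∈ r '' {x | x < 64} := ⟨0, by simp, rfl⟩
    have h1 := hfo _ h0
    obtain ⟨n, hn⟩ := Nat.exists_eq_succ_of_ne_zero (orderOf_pos_iff.2 h1).ne'
    have := hpow _ h0 n
    rwa [← Nat.succ_eq_add_one, ← hn, pow_orderOf_eq_one] at this
  have hinv : ∀ a : G, a ∈ r '' {x | x < 64} → a⁻¹ ∈ r '' {x | x < 64} := by
    intro a ha
    have h1 := hfo _ ha
    obtain ⟨n, hn⟩ := Nat.exists_eq_succ_of_ne_zero (orderOf_pos_iff.2 h1).ne'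
    have h2 : a ^ n * a = 1 := by rw [← pow_succ, ← Nat.succ_eq_add_one, ← hn, pow_orderOf_eq_one]
    rw [← eq_inv_of_mul_eq_one_left h2]
    rcases n with _ | n
    · simpa using hone
    · exact hpow a ha n
  intro g hg
  have : g ∈ r '' {x | x < 64} := by
    induction hg using Subgroup.closure_induction with
    | mem x hx => obtain ⟨y, hy, h⟩ := hS x hx; exact ⟨y, hy, h⟩
    | one => exact hone
    | mul x y _ _ hx hy => exact hmul _ _ hx hy
    | inv x _ hx => exact hinv _ hx
  obtain ⟨x, hx, h⟩ := this
  exact ⟨x, hx, h⟩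

theorem exists_model {H G : Type*} [Group H] [Group G] (m : ℕ → ℕ → ℕ) (r : ℕ → G)
    (lt : ∀ x < 64, ∀ y < 64, m x y < 64)
    (mul : ∀ x < 64, ∀ y < 64, r (m x y) = r x * r y)
    (S : Set G) (hS : ∀ s ∈ S, ∃ x < 64, r x = s)
    (K : Subgroup H) (hK : Nat.card K = 64) (e : K ≃* Subgroup.closure S) :
    ∃ r' : ℕ → H, IsModelBy m K r' := by
  have hcl := closure_subset_image m r lt mul S hS
  have hcard : Nat.card (Subgroup.closure S) = 64 := by rw [← hK]; exact (Nat.card_congr e.toEquiv).symm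
  have hfin0 : ({x | x < 64} : Set ℕ).Finite := Set.finite_lt_nat 64
  have hc0 : ({x | x < 64} : Set ℕ).ncard = 64 := by
    have : ({x | x < 64} : Set ℕ) = (Finset.range 64 : Finset ℕ) := by ext; simp
    rw [this, Set.ncard_coe_finset]; simp
  have hfin : (r '' {x | x < 64}).Finite := hfin0.image r
  have hle : (r '' {x | x < 64}).ncard ≤ 64 :=
    (Set.ncard_image_le hfin0).trans hc0.le
  have hsub : ((Subgroup.closure S : Subgroup G) : Set G) ⊆ r '' {x | x < 64} := by
    intro g hg
    obtain ⟨x, hx, h⟩ := hcl g hg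
    exact ⟨x, hx, h⟩
  have hncl : ((Subgroup.closure S : Subgroup G) : Set G).ncard = 64 := hcard
  have heq := Set.eq_of_subset_of_ncard_le hsub (by rw [hncl]; exact hle) hfin
  have hinj : Set.InjOn r {x | x < 64} := by
    rw [← Set.ncard_image_iff hfin0, ← heq, hncl, hc0]
  have hmem : ∀ x < 64, r x ∈ Subgroup.closure S := by
    intro x hx
    have : r x ∈ ((Subgroup.closure S : Subgroup G) : Set G) := by
      rw [heq]; exact ⟨x, hx, rfl⟩
    exact this
  classical
  refine ⟨fun x => if hx : x < 64 then (e.symm ⟨r x, hmem x hx⟩ : K) else 1, ?_, ?_, ?_, lt, ?_⟩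
  · intro x hx
    simp [hx]
  · intro k hk
    obtain ⟨x, hx, h⟩ := hcl (e ⟨k, hk⟩ : Subgroup.closure S) (e ⟨k, hk⟩).2
    refine ⟨x, hx, ?_⟩
    have h2 : (⟨r x, hmem x hx⟩ : Subgroup.closure S) = e ⟨k, hk⟩ := Subtype.ext h
    simp [hx, h2]
  · intro x hx y hy h
    simp only [hx, hy, dif_pos] at h
    have h2 := e.symm.injective (Subtype.ext h)
    exact hinj hx hy (congrArg Subtype.val h2)
  · intro x hx y hy
    simp only [hx, hy, lt x hx y hy, dif_pos]
    rw [← Subgroup.coe_mul, ← map_mul]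
    congr 2
    exact Subtype.ext (mul x hx y hy)

/-! ### Monomial computations in `PGL(8, ℂ)` -/

theorem monomial_apply (c : Fin 8 → ℂˣ) (e : Equiv.Perm (Fin 8)) (x : V8) (i : Fin 8) :
    monomial c e x i = (c i : ℂ) * x (e i) := rfl

theorem monomial_mul (c d : Fin 8 → ℂˣ) (e f : Equiv.Perm (Fin 8)) :
    monomial c e * monomial d f = monomial (fun i => c i * d (e i)) (f * e) := by
  apply LinearEquiv.ext
  intro x
  funext i
  change monomial c e (monomial d f x) i = _
  simp only [monomial_apply, Units.val_mul, Equiv.Perm.mul_apply]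
  ring

theorem mk8_mul (c d : Fin 8 → ℂˣ) (e f : Equiv.Perm (Fin 8)) :
    mk8 c e * mk8 d f = mk8 (fun i => c i * d (e i)) (f * e) := by
  unfold mk8
  rw [← monomial_mul]
  rfl

theorem mk8_eq (c d : Fin 8 → ℂˣ) (e f : Equiv.Perm (Fin 8)) (hef : ∀ i, e i = f i)
    (u : ℂˣ) (hu : ∀ i, c i = u * d i) : mk8 c e = mk8 d f := by
  obtain rfl : e = f := Equiv.ext hef
  unfold mk8
  have hc : LinearEquiv.smulOfUnit (M := V8) u ∈ Subgroup.center GL8 := by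
    rw [Subgroup.mem_center_iff]
    intro g
    apply LinearEquiv.ext
    intro x
    change g (u • x) = u • g x
    exact g.map_smul (u : ℂ) x
  have : monomial c e = LinearEquiv.smulOfUnit (M := V8) u * monomial d e := by
    apply LinearEquiv.ext
    intro x
    funext i
    change _ = ((u : ℂ) • monomial d e x) i
    simp only [monomial_apply, hu, Units.val_mul, Pi.smul_apply, smul_eq_mul]
    ring
  rw [this, QuotientGroup.mk_mul, (QuotientGroup.eq_one_iff _).2 hc, one_mul]

open Classical in
/-- The permutation with values `f i % 8`. -/
noncomputable def permOf (f : ℕ → ℕ) : Equiv.Perm (Fin 8) :=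
  if h : Function.Bijective (fun i : Fin 8 => (⟨f i % 8, Nat.mod_lt _ (by norm_num)⟩ : Fin 8))
  then Equiv.ofBijective _ h else 1

theorem permOf_apply (f : ℕ → ℕ) (h1 : ∀ i < 8, f i < 8)
    (h2 : ∀ i < 8, ∀ j < 8, f i = f j → i = j) (i : Fin 8) : (permOf f i : ℕ) = f i := by
  have h : Function.Bijective
      (fun i : Fin 8 => (⟨f i % 8, Nat.mod_lt _ (by norm_num)⟩ : Fin 8)) := by
    rw [← Finite.injective_iff_bijective]
    intro i j hij
    have := congrArg Fin.val hij
    simp only [Nat.mod_eq_of_lt (h1 i i.2), Nat.mod_eq_of_lt (h1 j j.2)] at this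
    exact Fin.ext (h2 i i.2 j j.2 this)
  unfold permOf
  rw [dif_pos h]
  simp [Nat.mod_eq_of_lt (h1 i i.2)]

/-- The element with code `x`. -/
noncomputable def rp (ξ : ℂˣ) (C E : ℕ → ℕ → ℕ) (x : ℕ) : PGL8 :=
  mk8 (fun i => ξ ^ (C x i)) (permOf (E x))

theorem rp_mul (ξ : ℂˣ) (hξ : ξ ^ 8 = 1) (C E m : ℕ → ℕ → ℕ) (S : List ℕ)
    (lt : ∀ x < 64, ∀ y < 64, m x y < 64)
    (h1 : ∀ x < 64, ∀ i < 8, E x i < 8)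
    (h2 : ∀ x < 64, ∀ i < 8, ∀ j < 8, E x i = E x j → i = j)
    (hS : ∀ y ∈ S, y < 64)
    (h3 : ∀ x < 64, ∀ y ∈ S, ∀ i < 8, E y (E x i) = E (m x y) i)
    (h4 : ∀ x < 64, ∀ y ∈ S, ∀ i < 8, (C x i + C y (E x i)) % 8 =
      (C x 0 + C y (E x 0) + 7 * C (m x y) 0 + C (m x y) i) % 8)
    (h5 : ∀ x < 64, ∀ y < 64, ∀ z ∈ S, m x (m y z) = m (m x y) z)
    (h6 : ∀ y < 64, y ∈ S ∨ ∃ z ∈ S, ∃ x < y, m x z = y) :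
    ∀ x < 64, ∀ y < 64, rp ξ C E (m x y) = rp ξ C E x * rp ξ C E y := by
  have key : ∀ x < 64, ∀ y ∈ S, rp ξ C E (m x y) = rp ξ C E x * rp ξ C E y := by
    intro x hx y hyS
    have hy := hS y hyS
    unfold rp
    rw [mk8_mul]
    symm
    have hm := lt x hx y hy
    refine mk8_eq _ _ _ _ ?_ (ξ ^ (C x 0 + C y (E x 0) + 7 * C (m x y) 0)) ?_
    · intro i
      apply Fin.ext
      rw [Equiv.Perm.mul_apply, permOf_apply _ (h1 y hy) (h2 y hy),
        permOf_apply _ (h1 x hx) (h2 x hx), permOf_apply _ (h1 _ hm) (h2 _ hm)]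
      exact h3 x hx y hyS i i.2
    · intro i
      rw [permOf_apply _ (h1 x hx) (h2 x hx), ← pow_add, ← pow_add]
      rw [pow_eq_pow_mod _ hξ, h4 x hx y hyS i i.2, ← pow_eq_pow_mod _ hξ]
  intro x hx y
  induction y using Nat.strong_induction_on with
  | _ y ih =>
    intro hy
    rcases h6 y hy with hyS | ⟨z, hz, y', hy', rfl⟩
    · exact key x hx y hyS
    · have hy'' := hy'.trans hy
      rw [h5 x hx y' hy'' z hz, key _ (lt x hx y' hy'') z hz, ih y' hy' hy'', key y' hy'' z hz,
        mul_assoc]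

theorem rp_eq (ξ : ℂˣ) (C E : ℕ → ℕ → ℕ) (x : ℕ)
    (h1 : ∀ i < 8, E x i < 8)
    (h2 : ∀ i < 8, ∀ j < 8, E x i = E x j → i = j)
    (c : Fin 8 → ℂˣ) (e : Equiv.Perm (Fin 8)) (he : ∀ i, (e i : ℕ) = E x i)
    (u : ℂˣ) (hc : ∀ i : Fin 8, c i = u * ξ ^ (C x i)) : rp ξ C E x = mk8 c e := by
  symm
  refine mk8_eq _ _ _ _ ?_ u hc
  intro i
  apply Fin.ext
  rw [he, permOf_apply _ h1 h2]

/-! ### The five groups are models of the multiplication tables -/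

/-- Exponents and permutations of the elements of `G₁`. -/
def C1 (x i : ℕ) : ℕ := (x / 8) * i
def E1 (x i : ℕ) : ℕ := (i + x % 8) % 8
/-- Exponents and permutations of the elements of `G₂`. -/
def E2 (x i : ℕ) : ℕ := if x % 2 = 0 then (i + x % 8) % 8 else (5 * i + 5 * (x % 8) + 2) % 8
/-- Exponents and permutations of the elements of `G₃`. -/
def C3 (x i : ℕ) : ℕ := (x % 8) * i
def E3 (x i : ℕ) : ℕ :=
  if x / 8 % 2 = 0 then (i + 2 * (x / 16)) % 8 else (3 * (i + 2 * (x / 16)) + 1) % 8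
/-- Exponents and permutations of the elements of `G₄` and `G₅`; the list encodes the exponents
of coset representatives in base `8`. -/
def C45 (l : List ℕ) (x i : ℕ) : ℕ :=
  l.getD (x / 8) 0 / 8 ^ i % 8 +
    4 * ((x % 2) * (i / 4) + (x / 2 % 2) * (i / 2 % 2) + (x / 4 % 2) * (i % 2))
def E45 (l : List ℕ) (x i : ℕ) : ℕ := i ^^^ (l.getD (x / 8) 0)

def l4 : List ℕ := [0, 4867200, 10101808, 5267888, 13241504, 8407072, 4202640, 9069840]
def l4' : List ℕ := [0, 4867200, 9071632, 4204944, 13241504, 8407072, 5269680, 10104112]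
def l5 : List ℕ := [0, 13241504, 13256064, 9453600, 5770368, 9568288, 1181728, 4722048]
def f4 : List ℕ := [0, 6, 1, 7, 4, 2, 5, 3]
def f5 : List ℕ := [0, 4, 6, 2, 5, 1, 3, 7]

theorem lt1 : ∀ x < 64, ∀ y < 64, mul12 0 x y < 64 := by decide +kernel
theorem lt2 : ∀ x < 64, ∀ y < 64, mul12 1 x y < 64 := by decide +kernel
theorem lt3 : ∀ x < 64, ∀ y < 64, mul3 x y < 64 := by decide +kernel
theorem lt4 : ∀ x < 64, ∀ y < 64, mul45 beta4 x y < 64 := by decide +kernel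
theorem lt5 : ∀ x < 64, ∀ y < 64, mul45 beta5 x y < 64 := by decide +kernel

theorem el1 : ∀ x < 64, ∀ i < 8, E1 x i < 8 := by decide +kernel
theorem el2 : ∀ x < 64, ∀ i < 8, E2 x i < 8 := by decide +kernel
theorem el3 : ∀ x < 64, ∀ i < 8, E3 x i < 8 := by decide +kernel
theorem el4 : ∀ x < 64, ∀ i < 8, E45 f4 x i < 8 := by decide +kernel
theorem el5 : ∀ x < 64, ∀ i < 8, E45 f5 x i < 8 := by decide +kernel

theorem ei1 : ∀ x < 64, ∀ i < 8, ∀ j < 8, E1 x i = E1 x j → i = j := by decide +kernel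
theorem ei2 : ∀ x < 64, ∀ i < 8, ∀ j < 8, E2 x i = E2 x j → i = j := by decide +kernel
theorem ei3 : ∀ x < 64, ∀ i < 8, ∀ j < 8, E3 x i = E3 x j → i = j := by decide +kernel
theorem ei4 : ∀ x < 64, ∀ i < 8, ∀ j < 8, E45 f4 x i = E45 f4 x j → i = j := by decide +kernel
theorem ei5 : ∀ x < 64, ∀ i < 8, ∀ j < 8, E45 f5 x i = E45 f5 x j → i = j := by decide +kernel

theorem xor_lt_eight {a b : ℕ} (ha : a < 8) (hb : b < 8) : a ^^^ b < 8 :=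
  Nat.xor_lt_two_pow (n := 3) ha hb

theorem mul45_assoc (β : ℕ → ℕ → ℕ) (hβ : ∀ v < 8, ∀ u < 8, β v u < 8)
    (hc : ∀ v < 8, ∀ u < 8, ∀ t < 8, β v (u ^^^ t) ^^^ β u t = β v u ^^^ β (v ^^^ u) t) :
    ∀ x < 64, ∀ y < 64, ∀ z < 64, mul45 β x (mul45 β y z) = mul45 β (mul45 β x y) z := by
  have hd : ∀ x < 64, ∀ y < 64, mul45 β x y / 8 = (x / 8) ^^^ (y / 8) ∧
      mul45 β x y % 8 = (x % 8) ^^^ (y % 8) ^^^ β (x / 8) (y / 8) := by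
    intro x hx y hy
    have h1 : (x % 8) ^^^ (y % 8) ^^^ β (x / 8) (y / 8) < 8 :=
      xor_lt_eight (xor_lt_eight (by omega) (by omega)) (hβ _ (by omega) _ (by omega))
    unfold mul45
    omega
  have hl : ∀ x < 64, ∀ y < 64, mul45 β x y < 64 := by
    intro x hx y hy
    have h1 := (hd x hx y hy).1
    have h2 : (x / 8) ^^^ (y / 8) < 8 := xor_lt_eight (by omega) (by omega)
    omega
  intro x hx y hy z hz
  have h1 := hd x hx _ (hl y hy z hz)
  have h2 := hd _ (hl x hx y hy) z hz
  have h3 := hd x hx y hy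
  have h4 := hd y hy z hz
  rw [h3.1, h3.2] at h2
  rw [h4.1, h4.2] at h1
  have h5 := hc (x / 8) (by omega) (y / 8) (by omega) (z / 8) (by omega)
  have h6 : mul45 β x (mul45 β y z) / 8 = mul45 β (mul45 β x y) z / 8 := by
    rw [h1.1, h2.1, Nat.xor_assoc]
  have h7 : mul45 β x (mul45 β y z) % 8 = mul45 β (mul45 β x y) z % 8 := by
    rw [h1.2, h2.2]
    calc _ = (x % 8) ^^^ (y % 8) ^^^ (z % 8) ^^^
          (β (x / 8) ((y / 8) ^^^ (z / 8)) ^^^ β (y / 8) (z / 8)) := by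
          simp only [Nat.xor_assoc, Nat.xor_comm, Nat.xor_left_comm]
      _ = _ := by
          rw [h5]
          simp only [Nat.xor_assoc, Nat.xor_comm, Nat.xor_left_comm]
  omega

def S1 : List ℕ := [0, 1, 8]
def S2 : List ℕ := [0, 1, 8]
def S3 : List ℕ := [0, 1, 8, 16]
def S4 : List ℕ := [0, 1, 2, 4, 8, 16, 32]
def S5 : List ℕ := [0, 1, 2, 4, 8, 16, 32]

theorem as1 : ∀ x < 64, ∀ y < 64, ∀ z ∈ S1, mul12 0 x (mul12 0 y z) = mul12 0 (mul12 0 x y) z := by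
  decide +kernel
theorem ge1 : ∀ y < 64, y ∈ S1 ∨ ∃ z ∈ S1, ∃ x < y, mul12 0 x z = y := by decide +kernel

theorem as2 : ∀ x < 64, ∀ y < 64, ∀ z ∈ S2, mul12 1 x (mul12 1 y z) = mul12 1 (mul12 1 x y) z := by
  decide +kernel
theorem ge2 : ∀ y < 64, y ∈ S2 ∨ ∃ z ∈ S2, ∃ x < y, mul12 1 x z = y := by decide +kernel

theorem as3 : ∀ x < 64, ∀ y < 64, ∀ z ∈ S3, mul3 x (mul3 y z) = mul3 (mul3 x y) z := by
  decide +kernel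
theorem ge3 : ∀ y < 64, y ∈ S3 ∨ ∃ z ∈ S3, ∃ x < y, mul3 x z = y := by decide +kernel

theorem as4 : ∀ x < 64, ∀ y < 64, ∀ z ∈ S4,
    mul45 beta4 x (mul45 beta4 y z) = mul45 beta4 (mul45 beta4 x y) z := by
  intro x hx y hy z hz
  have hz' : z < 64 := (show ∀ z ∈ S4, z < 64 by decide +kernel) z hz
  exact mul45_assoc beta4 (by decide +kernel) (by decide +kernel) x hx y hy z hz'
theorem ge4 : ∀ y < 64, y ∈ S4 ∨ ∃ z ∈ S4, ∃ x < y, mul45 beta4 x z = y := by decide +kernel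

theorem as5 : ∀ x < 64, ∀ y < 64, ∀ z ∈ S5,
    mul45 beta5 x (mul45 beta5 y z) = mul45 beta5 (mul45 beta5 x y) z := by
  intro x hx y hy z hz
  have hz' : z < 64 := (show ∀ z ∈ S5, z < 64 by decide +kernel) z hz
  exact mul45_assoc beta5 (by decide +kernel) (by decide +kernel) x hx y hy z hz'
theorem ge5 : ∀ y < 64, y ∈ S5 ∨ ∃ z ∈ S5, ∃ x < y, mul45 beta5 x z = y := by decide +kernel

theorem rp1 (ξ : ℂˣ) (hξ : ξ ^ 8 = 1) : ∀ x < 64, ∀ y < 64,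
    rp ξ C1 E1 (mul12 0 x y) = rp ξ C1 E1 x * rp ξ C1 E1 y :=
  rp_mul ξ hξ _ _ _ S1 lt1 el1 ei1 (by decide +kernel) (by decide +kernel)
    (by decide +kernel) as1 ge1

theorem rp2 (ξ : ℂˣ) (hξ : ξ ^ 8 = 1) : ∀ x < 64, ∀ y < 64,
    rp ξ C1 E2 (mul12 1 x y) = rp ξ C1 E2 x * rp ξ C1 E2 y :=
  rp_mul ξ hξ _ _ _ S2 lt2 el2 ei2 (by decide +kernel) (by decide +kernel)
    (by decide +kernel) as2 ge2

theorem rp3 (ξ : ℂˣ) (hξ : ξ ^ 8 = 1) : ∀ x < 64, ∀ y < 64,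
    rp ξ C3 E3 (mul3 x y) = rp ξ C3 E3 x * rp ξ C3 E3 y :=
  rp_mul ξ hξ _ _ _ S3 lt3 el3 ei3 (by decide +kernel) (by decide +kernel)
    (by decide +kernel) as3 ge3

theorem rp4 (ξ : ℂˣ) (hξ : ξ ^ 8 = 1) : ∀ x < 64, ∀ y < 64,
    rp ξ (C45 l4) (E45 f4) (mul45 beta4 x y) =
      rp ξ (C45 l4) (E45 f4) x * rp ξ (C45 l4) (E45 f4) y :=
  rp_mul ξ hξ _ _ _ S4 lt4 el4 ei4 (by decide +kernel) (by decide +kernel)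
    (by decide +kernel) as4 ge4

theorem rp4' (ξ : ℂˣ) (hξ : ξ ^ 8 = 1) : ∀ x < 64, ∀ y < 64,
    rp ξ (C45 l4') (E45 f4) (mul45 beta4 x y) =
      rp ξ (C45 l4') (E45 f4) x * rp ξ (C45 l4') (E45 f4) y :=
  rp_mul ξ hξ _ _ _ S4 lt4 el4 ei4 (by decide +kernel) (by decide +kernel)
    (by decide +kernel) as4 ge4

theorem rp5 (ξ : ℂˣ) (hξ : ξ ^ 8 = 1) : ∀ x < 64, ∀ y < 64,
    rp ξ (C45 l5) (E45 f5) (mul45 beta5 x y) =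
      rp ξ (C45 l5) (E45 f5) x * rp ξ (C45 l5) (E45 f5) y :=
  rp_mul ξ hξ _ _ _ S5 lt5 el5 ei5 (by decide +kernel) (by decide +kernel)
    (by decide +kernel) as5 ge5

set_option linter.unusedSimpArgs false
theorem xi8 (ξ : ℂˣ) (hξ : IsPrimitiveRoot (ξ : ℂ) 8) : ξ ^ 8 = 1 := by
  ext; simpa using hξ.pow_eq_one

theorem xi4 (ξ : ℂˣ) (hξ : IsPrimitiveRoot (ξ : ℂ) 8) : ξ ^ 4 = -1 := by
  ext
  have h8 : (ξ : ℂ) ^ 8 = 1 := hξ.pow_eq_one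
  have h4 : (ξ : ℂ) ^ 4 ≠ 1 := hξ.pow_ne_one_of_pos_of_lt (by norm_num) (by norm_num)
  have : ((ξ : ℂ) ^ 4 - 1) * ((ξ : ℂ) ^ 4 + 1) = 0 := by linear_combination h8
  rcases mul_eq_zero.1 this with h | h
  · exact absurd (sub_eq_zero.1 h) h4
  · push_cast
    exact eq_neg_of_add_eq_zero_left h

theorem Iu_cases (ξ : ℂˣ) (hξ : IsPrimitiveRoot (ξ : ℂ) 8) : Iu = ξ ^ 2 ∨ Iu = ξ ^ 6 := by
  have h4 : (ξ : ℂ) ^ 4 = -1 := by have := congrArg Units.val (xi4 ξ hξ); simpa using this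
  have hI : (Iu : ℂ) ^ 2 = -1 := by simp [Iu]
  have : ((Iu : ℂ) - ξ ^ 2) * ((Iu : ℂ) + ξ ^ 2) = 0 := by linear_combination hI - h4
  rcases mul_eq_zero.1 this with h | h
  · left; ext; push_cast; exact sub_eq_zero.1 h
  · right; ext; push_cast
    linear_combination h - (ξ : ℂ) ^ 2 * h4

theorem model1 {H : Type*} [Group H] (ξ : ℂˣ) (hξ : IsPrimitiveRoot (ξ : ℂ) 8)
    (K : Subgroup H) (hK : Nat.card K = 64)
    (e : K ≃* Subgroup.closure
    {mk8 (fun i => ξ ^ (i : ℕ)) 1, mk8 1 (finRotate 8)}) : ∃ r, IsModelBy (mul12 0) K r := by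
  refine exists_model _ _ lt1 (rp1 ξ (xi8 ξ hξ)) _ ?_ K hK e
  rintro s (rfl | rfl)
  · exact ⟨8, by norm_num, rp_eq ξ _ _ 8 (el1 8 (by norm_num)) (ei1 8 (by norm_num)) _ _
      (by decide) 1 (by intro i; simp [C1])⟩
  · exact ⟨1, by norm_num, rp_eq ξ _ _ 1 (el1 1 (by norm_num)) (ei1 1 (by norm_num)) _ _
      (by decide) 1 (by intro i; simp [C1])⟩

theorem model2 {H : Type*} [Group H] (ξ : ℂˣ) (hξ : IsPrimitiveRoot (ξ : ℂ) 8)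
    (K : Subgroup H) (hK : Nat.card K = 64)
    (e : K ≃* Subgroup.closure
    {mk8 (fun i => ξ ^ (i : ℕ)) 1, mk8 1 ([(0 : Fin 8), 7, 2, 1, 4, 3, 6, 5].formPerm)}) :
    ∃ r, IsModelBy (mul12 1) K r := by
  refine exists_model _ _ lt2 (rp2 ξ (xi8 ξ hξ)) _ ?_ K hK e
  rintro s (rfl | rfl)
  · exact ⟨8, by norm_num, rp_eq ξ _ _ 8 (el2 8 (by norm_num)) (ei2 8 (by norm_num)) _ _
      (by decide) 1 (by intro i; simp [C1])⟩
  · exact ⟨1, by norm_num, rp_eq ξ _ _ 1 (el2 1 (by norm_num)) (ei2 1 (by norm_num)) _ _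
      (by decide) 1 (by intro i; simp [C1])⟩

theorem model3 {H : Type*} [Group H] (ξ : ℂˣ) (hξ : IsPrimitiveRoot (ξ : ℂ) 8)
    (K : Subgroup H) (hK : Nat.card K = 64)
    (e : K ≃* Subgroup.closure
    {mk8 (fun i => ξ ^ (i : ℕ)) 1,
      mk8 1 ([(0 : Fin 8), 2, 4, 6].formPerm * [(1 : Fin 8), 3, 5, 7].formPerm),
      mk8 1 ([(0 : Fin 8), 1, 4, 5].formPerm * [(3 : Fin 8), 2, 7, 6].formPerm)}) :
    ∃ r, IsModelBy mul3 K r := by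
  refine exists_model _ _ lt3 (rp3 ξ (xi8 ξ hξ)) _ ?_ K hK e
  rintro s (rfl | rfl | rfl)
  · exact ⟨1, by norm_num, rp_eq ξ _ _ 1 (el3 1 (by norm_num)) (ei3 1 (by norm_num)) _ _
      (by decide) 1 (by intro i; simp [C3])⟩
  · exact ⟨16, by norm_num, rp_eq ξ _ _ 16 (el3 16 (by norm_num)) (ei3 16 (by norm_num)) _ _
      (by decide) 1 (by intro i; simp [C3])⟩
  · exact ⟨8, by norm_num, rp_eq ξ _ _ 8 (el3 8 (by norm_num)) (ei3 8 (by norm_num)) _ _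
      (by decide) 1 (by intro i; simp [C3])⟩

/-- A variant of `rp_eq` where the coefficients are given as powers of `ξ`. -/
theorem rp_eq2 (ξ : ℂˣ) (hξ : ξ ^ 8 = 1) (C E : ℕ → ℕ → ℕ) (x : ℕ)
    (h1 : ∀ i < 8, E x i < 8)
    (h2 : ∀ i < 8, ∀ j < 8, E x i = E x j → i = j)
    (c : Fin 8 → ℂˣ) (e : Equiv.Perm (Fin 8)) (he : ∀ i, (e i : ℕ) = E x i)
    (u : ℕ) (d : Fin 8 → ℕ) (hcd : ∀ i, c i = ξ ^ (d i))
    (hd : ∀ i : Fin 8, d i % 8 = (u + C x i) % 8) : rp ξ C E x = mk8 c e := by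
  refine rp_eq ξ C E x h1 h2 c e he (ξ ^ u) ?_
  intro i
  rw [hcd, ← pow_add, pow_eq_pow_mod _ hξ, hd, ← pow_eq_pow_mod _ hξ]

theorem model4 {H : Type*} [Group H] (ξ : ℂˣ) (hξ : IsPrimitiveRoot (ξ : ℂ) 8)
    (K : Subgroup H) (hK : Nat.card K = 64)
    (e : K ≃* Subgroup.closure
    {mk8 ![ξ, ξ, ξ ^ 3, ξ ^ 3, -ξ, -ξ, ξ ^ 3, ξ ^ 3] eA,
      mk8 ![-1, Iu, -1, -Iu, -Iu, 1, Iu, 1] eB,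
      mk8 ![ξ ^ 3, -ξ ^ 3, -ξ, ξ, ξ ^ 3, -ξ ^ 3, -ξ, ξ] eC}) :
    ∃ r, IsModelBy (mul45 beta4) K r := by
  have hn : ∀ a : ℂˣ, -a = ξ ^ 4 * a := by intro a; rw [xi4 ξ hξ]; simp
  rcases Iu_cases ξ hξ with hI | hI
  · refine exists_model _ _ lt4 (rp4 ξ (xi8 ξ hξ)) _ ?_ K hK e
    rintro s (rfl | rfl | rfl)
    · exact ⟨8, by norm_num, rp_eq2 ξ (xi8 ξ hξ) _ _ 8 (el4 8 (by norm_num))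
      (ei4 8 (by norm_num)) _ _ (by decide) 1 ![1, 1, 3, 3, 5, 5, 3, 3]
      (by intro i; fin_cases i <;> simp [hn, hI, ← pow_add, ← pow_succ, ← pow_succ'])
      (by decide)⟩
    · exact ⟨16, by norm_num, rp_eq2 ξ (xi8 ξ hξ) _ _ 16 (el4 16 (by norm_num))
      (ei4 16 (by norm_num)) _ _ (by decide) 4 ![4, 2, 4, 6, 6, 0, 2, 0]
      (by intro i; fin_cases i <;> simp [hn, hI, ← pow_add, ← pow_succ, ← pow_succ'])
      (by decide)⟩
    · exact ⟨32, by norm_num, rp_eq2 ξ (xi8 ξ hξ) _ _ 32 (el4 32 (by norm_num))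
      (ei4 32 (by norm_num)) _ _ (by decide) 3 ![3, 7, 5, 1, 3, 7, 5, 1]
      (by intro i; fin_cases i <;> simp [hn, hI, ← pow_add, ← pow_succ, ← pow_succ'])
      (by decide)⟩
  · refine exists_model _ _ lt4 (rp4' ξ (xi8 ξ hξ)) _ ?_ K hK e
    rintro s (rfl | rfl | rfl)
    · exact ⟨8, by norm_num, rp_eq2 ξ (xi8 ξ hξ) _ _ 8 (el4 8 (by norm_num))
      (ei4 8 (by norm_num)) _ _ (by decide) 1 ![1, 1, 3, 3, 5, 5, 3, 3]
      (by intro i; fin_cases i <;> simp [hn, hI, ← pow_add, ← pow_succ, ← pow_succ'])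
      (by decide)⟩
    · exact ⟨16, by norm_num, rp_eq2 ξ (xi8 ξ hξ) _ _ 16 (el4 16 (by norm_num))
      (ei4 16 (by norm_num)) _ _ (by decide) 4 ![4, 6, 4, 10, 10, 0, 6, 0]
      (by intro i; fin_cases i <;> simp [hn, hI, ← pow_add, ← pow_succ, ← pow_succ'])
      (by decide)⟩
    · exact ⟨32, by norm_num, rp_eq2 ξ (xi8 ξ hξ) _ _ 32 (el4 32 (by norm_num))
      (ei4 32 (by norm_num)) _ _ (by decide) 3 ![3, 7, 5, 1, 3, 7, 5, 1]
      (by intro i; fin_cases i <;> simp [hn, hI, ← pow_add, ← pow_succ, ← pow_succ'])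
      (by decide)⟩

theorem model5 {H : Type*} [Group H] (ξ : ℂˣ) (hξ : IsPrimitiveRoot (ξ : ℂ) 8)
    (K : Subgroup H) (hK : Nat.card K = 64)
    (e : K ≃* Subgroup.closure
    {mk8 ![ξ ^ 3, -ξ ^ 3, -ξ, ξ, ξ ^ 3, -ξ ^ 3, -ξ, ξ] eC,
      mk8 ![ξ, ξ, -ξ ^ 3, ξ ^ 3, -ξ, -ξ, ξ ^ 3, -ξ ^ 3] eA,
      mk8 ![ξ ^ 3, ξ ^ 3, -ξ, ξ, ξ ^ 3, ξ ^ 3, ξ, -ξ] eD}) :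
    ∃ r, IsModelBy (mul45 beta5) K r := by
  have hn : ∀ a : ℂˣ, -a = ξ ^ 4 * a := by intro a; rw [xi4 ξ hξ]; simp
  have hI : True := trivial
  refine exists_model _ _ lt5 (rp5 ξ (xi8 ξ hξ)) _ ?_ K hK e
  rintro s (rfl | rfl | rfl)
  · exact ⟨8, by norm_num, rp_eq2 ξ (xi8 ξ hξ) _ _ 8 (el5 8 (by norm_num))
      (ei5 8 (by norm_num)) _ _ (by decide) 3 ![3, 7, 5, 1, 3, 7, 5, 1]
      (by intro i; fin_cases i <;> simp [hn, hI, ← pow_add, ← pow_succ, ← pow_succ'])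
      (by decide)⟩
  · exact ⟨16, by norm_num, rp_eq2 ξ (xi8 ξ hξ) _ _ 16 (el5 16 (by norm_num))
      (ei5 16 (by norm_num)) _ _ (by decide) 1 ![1, 1, 7, 3, 5, 5, 3, 7]
      (by intro i; fin_cases i <;> simp [hn, hI, ← pow_add, ← pow_succ, ← pow_succ'])
      (by decide)⟩
  · exact ⟨32, by norm_num, rp_eq2 ξ (xi8 ξ hξ) _ _ 32 (el5 32 (by norm_num))
      (ei5 32 (by norm_num)) _ _ (by decide) 3 ![3, 3, 5, 1, 3, 3, 1, 5]
      (by intro i; fin_cases i <;> simp [hn, hI, ← pow_add, ← pow_succ, ← pow_succ'])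
      (by decide)⟩

/-! ### Properties of the five groups, transferred from the multiplication tables -/

namespace IsModelBy
variable {H : Type*} [Group H] {m : ℕ → ℕ → ℕ} {K : Subgroup H} {r : ℕ → H}

theorem mul_eq (h : IsModelBy m K r) (x y : ℕ) (hx : x < 64) (hy : y < 64) :
    r x * r y = r (m x y) := (h.mul x hx y hy).symm

theorem sq_eq (h : IsModelBy m K r) (x : ℕ) (hx : x < 64) : r x ^ 2 = r (p2 m x) := by
  rw [sq, h.mul_eq x x hx hx, p2]

theorem p2_lt (h : IsModelBy m K r) (x : ℕ) (hx : x < 64) : p2 m x < 64 := h.lt x hx x hx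

theorem p4_lt (h : IsModelBy m K r) (x : ℕ) (hx : x < 64) : p4 m x < 64 :=
  h.p2_lt _ (h.p2_lt x hx)

theorem iv_lt (h : IsModelBy m K r) (x : ℕ) (hx : x < 64) : iv m x < 64 :=
  h.lt x hx _ (h.lt _ (h.p2_lt x hx) _ (h.p4_lt x hx))

theorem pow_four_eq (h : IsModelBy m K r) (x : ℕ) (hx : x < 64) : r x ^ 4 = r (p4 m x) := by
  rw [show 4 = 2 * 2 by norm_num, pow_mul, h.sq_eq x hx, h.sq_eq _ (h.p2_lt x hx), p4]

theorem zero_eq (h : IsModelBy m K r) (h0 : m 0 0 = 0) : r 0 = 1 := by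
  have := h.mul 0 (by norm_num) 0 (by norm_num)
  rw [h0] at this
  exact left_eq_mul.1 this

theorem eq_one_iff (h : IsModelBy m K r) (h0 : m 0 0 = 0) (x : ℕ) (hx : x < 64) :
    r x = 1 ↔ x = 0 := by
  rw [← h.zero_eq h0]
  exact ⟨fun h1 => h.inj x hx 0 (by norm_num) h1, fun h1 => by rw [h1]⟩

theorem eq_iff (h : IsModelBy m K r) (x y : ℕ) (hx : x < 64) (hy : y < 64) :
    r x = r y ↔ x = y :=
  ⟨fun h1 => h.inj x hx y hy h1, fun h1 => by rw [h1]⟩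

theorem pow_eight_eq (h : IsModelBy m K r) (h0 : m 0 0 = 0)
    (h8 : ∀ x < 64, p2 m (p4 m x) = 0) (x : ℕ) (hx : x < 64) : r x ^ 8 = 1 := by
  rw [show 8 = 4 * 2 by norm_num, pow_mul, h.pow_four_eq x hx, h.sq_eq _ (h.p4_lt x hx),
    h8 x hx, h.zero_eq h0]

theorem inv_eq (h : IsModelBy m K r) (h0 : m 0 0 = 0)
    (h8 : ∀ x < 64, p2 m (p4 m x) = 0) (x : ℕ) (hx : x < 64) : (r x)⁻¹ = r (iv m x) := by
  have h1 : r (iv m x) = r x ^ 7 := by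
    rw [iv, h.mul x hx _ (h.lt _ (h.p2_lt x hx) _ (h.p4_lt x hx)),
      h.mul _ (h.p2_lt x hx) _ (h.p4_lt x hx), ← h.sq_eq x hx, ← h.pow_four_eq x hx]
    group
  rw [h1, inv_eq_iff_mul_eq_one, ← pow_succ']
  exact h.pow_eight_eq h0 h8 x hx

theorem ncard_eq (h : IsModelBy m K r) (Q : H → Prop) (P : ℕ → Prop) [DecidablePred P]
    (hPQ : ∀ x < 64, Q (r x) ↔ P x) :
    {k : H | k ∈ K ∧ Q k}.ncard = ((Finset.range 64).filter P).card := by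
  have : {k : H | k ∈ K ∧ Q k} = r '' ((Finset.range 64).filter P : Finset ℕ) := by
    ext k
    constructor
    · rintro ⟨hk, hQ⟩
      obtain ⟨x, hx, rfl⟩ := h.surj k hk
      exact ⟨x, by simpa using ⟨hx, (hPQ x hx).1 hQ⟩, rfl⟩
    · rintro ⟨x, hx, rfl⟩
      have hx' : x < 64 ∧ P x := by simpa using hx
      exact ⟨h.mem x hx'.1, (hPQ x hx'.1).2 hx'.2⟩
  rw [this, Set.InjOn.ncard_image, Set.ncard_coe_finset]
  intro x hx y hy hxy
  have hx' : x < 64 ∧ P x := by simpa using hx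
  have hy' : y < 64 ∧ P y := by simpa using hy
  exact h.inj x hx'.1 y hy'.1 hxy
end IsModelBy

/-- Properties of the groups `G₁`, `G₂`. -/
structure T12 {H : Type*} [Group H] (K : Subgroup H) : Prop where
  e8 : ∀ x ∈ K, x ^ 8 = 1
  s4 : ∀ x ∈ K, ∀ y ∈ K, x ^ 4 = 1 → y ^ 4 = 1 → (x * y) ^ 4 = 1
  c4 : {x | x ∈ K ∧ x ^ 4 = 1}.ncard = 16
  c2 : {x | x ∈ K ∧ x ^ 2 = 1}.ncard = 4
  surj : ∀ v ∈ K, v ^ 2 = 1 → v ≠ 1 → ∃ a ∈ K, a ^ 4 = v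
  inj : ∀ a ∈ K, ∀ t ∈ K, a ^ 4 = t ^ 4 → (a * t) ^ 4 = 1
  com : ∀ x ∈ K, ∀ y ∈ K, x ^ 2 = 1 → y ^ 2 = 1 → x * y = y * x

theorem t12_of {H : Type*} [Group H] {m : ℕ → ℕ → ℕ} {K : Subgroup H} {r : ℕ → H}
    (h : IsModelBy m K r) (h0 : m 0 0 = 0)
    (h8 : ∀ x < 64, p2 m (p4 m x) = 0)
    (h1 : ∀ x < 64, ∀ y < 64, p4 m x = 0 → p4 m y = 0 → p4 m (m x y) = 0)
    (h2 : ((Finset.range 64).filter fun x => p4 m x = 0).card = 16)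
    (h3 : ((Finset.range 64).filter fun x => p2 m x = 0).card = 4)
    (h4 : ∀ v < 64, p2 m v = 0 → v ≠ 0 → ∃ a < 64, p4 m a = v)
    (h5 : ∀ x < 64, ∀ y < 64, p4 m x = p4 m y → p4 m (m x y) = 0)
    (h6 : ∀ x < 64, ∀ y < 64, p2 m x = 0 → p2 m y = 0 → m x y = m y x) : T12 K where
  e8 := by
    intro x hxK
    obtain ⟨x, hx, rfl⟩ := h.surj x hxK
    exact h.pow_eight_eq h0 h8 x hx
  s4 := by
    intro x hxK y hyK
    obtain ⟨x, hx, rfl⟩ := h.surj x hxK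
    obtain ⟨y, hy, rfl⟩ := h.surj y hyK
    simp (maxDischargeDepth := 12) only [h.mul_eq, h.pow_four_eq, h.eq_one_iff h0, h.p4_lt, h.lt, hx, hy]
    exact h1 x hx y hy
  c4 := by
    rw [h.ncard_eq (fun x => x ^ 4 = 1) (fun x => p4 m x = 0), h2]
    intro x hx
    simp (maxDischargeDepth := 12) only [h.pow_four_eq, h.eq_one_iff h0, h.p4_lt, hx]
  c2 := by
    rw [h.ncard_eq (fun x => x ^ 2 = 1) (fun x => p2 m x = 0), h3]
    intro x hx
    simp (maxDischargeDepth := 12) only [h.sq_eq, h.eq_one_iff h0, h.p2_lt, hx]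
  surj := by
    intro x hxK
    obtain ⟨x, hx, rfl⟩ := h.surj x hxK
    simp (maxDischargeDepth := 12) only [h.sq_eq, h.eq_one_iff h0, h.p2_lt, hx, ne_eq]
    intro ha hb
    obtain ⟨a, hal, ha'⟩ := h4 x hx ha hb
    exact ⟨r a, h.mem a hal, by rw [h.pow_four_eq a hal, ha']⟩
  inj := by
    intro x hxK y hyK
    obtain ⟨x, hx, rfl⟩ := h.surj x hxK
    obtain ⟨y, hy, rfl⟩ := h.surj y hyK
    simp (maxDischargeDepth := 12) only [h.mul_eq, h.pow_four_eq, h.eq_one_iff h0, h.eq_iff, h.p4_lt, h.lt, hx, hy]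
    exact h5 x hx y hy
  com := by
    intro x hxK y hyK
    obtain ⟨x, hx, rfl⟩ := h.surj x hxK
    obtain ⟨y, hy, rfl⟩ := h.surj y hyK
    simp (maxDischargeDepth := 12) only [h.mul_eq, h.sq_eq, h.eq_one_iff h0, h.eq_iff, h.p2_lt,
      h.lt, hx, hy]
    exact h6 x hx y hy

theorem t12_of_one {H : Type*} [Group H] {K : Subgroup H} {r : ℕ → H}
    (h : IsModelBy (mul12 0) K r) : T12 K :=
  t12_of h (by decide) (by decide +kernel) (by decide +kernel) (by decide +kernel)
    (by decide +kernel) (by decide +kernel) (by decide +kernel) (by decide +kernel)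

theorem t12_of_two {H : Type*} [Group H] {K : Subgroup H} {r : ℕ → H}
    (h : IsModelBy (mul12 1) K r) : T12 K :=
  t12_of h (by decide) (by decide +kernel) (by decide +kernel) (by decide +kernel)
    (by decide +kernel) (by decide +kernel) (by decide +kernel) (by decide +kernel)


/-- The elements of the distinguished subgroup of index two of `G₃`. -/
def IsA {H : Type*} [Group H] (K : Subgroup H) (k : H) : Prop :=
  k ^ 4 ≠ 1 ∨ ∃ b ∈ K, b ^ 4 ≠ 1 ∧ (b * k) ^ 4 ≠ 1

/-- Properties of the group `G₃`. -/
structure T3 {H : Type*} [Group H] (K : Subgroup H) : Prop where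
  e8 : ∀ x ∈ K, x ^ 8 = 1
  c4 : {x | x ∈ K ∧ x ^ 4 ≠ 1}.ncard = 16
  c2 : {x | x ∈ K ∧ x ^ 2 = 1}.ncard = 4
  gen : ∀ a ∈ K, ∀ t ∈ K, a ^ 4 ≠ 1 → t ^ 2 = a ^ 4 → ∃ b ∈ K, b ^ 4 ≠ 1 ∧ (b * t) ^ 4 ≠ 1
  sq : ∀ w ∈ K, w ^ 2 = 1 → ∃ y ∈ K, w = y ^ 2
  cen : ∀ w ∈ K, ∀ x ∈ K, w ^ 2 = 1 → w * x = x * w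
  f0 : ∀ a ∈ K, ∀ y ∈ K, a ^ 4 ≠ 1 → y ^ 4 ≠ 1 → (a⁻¹ * y) ^ 4 = 1
  f1 : ∀ a ∈ K, ∀ y ∈ K, ∀ z ∈ K, a ^ 4 ≠ 1 → y ^ 4 ≠ 1 → z ^ 4 ≠ 1 →
    (y⁻¹ * z) ^ 2 = (a⁻¹ * y) ^ 2 → (a⁻¹ * z) ^ 2 = 1
  f2 : ∀ a ∈ K, ∀ k ∈ K, a ^ 4 ≠ 1 → (a⁻¹ * (k * a * k⁻¹)) ^ 2 = 1 → IsA K k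
  f3 : ∀ a ∈ K, ∀ k ∈ K, a ^ 4 ≠ 1 → ¬ IsA K k → (k * a * k⁻¹ * a) ^ 2 = 1
  ex : ∃ a ∈ K, a ^ 4 ≠ 1
  amul : ∀ x ∈ K, ∀ y ∈ K, IsA K x → IsA K y → IsA K (x * y)
  aone : IsA K 1
  ainv : ∀ x ∈ K, IsA K x → IsA K x⁻¹
  cA : {x | x ∈ K ∧ IsA K x}.ncard = 32

theorem t3_d8 : ∀ x < 64, p2 mul3 (p4 mul3 x) = 0 := by decide +kernel
theorem t3_c4 : ((Finset.range 64).filter fun x => p4 mul3 x ≠ 0).card = 16 := by decide +kernel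
theorem t3_c2 : ((Finset.range 64).filter fun x => p2 mul3 x = 0).card = 4 := by decide +kernel
theorem t3_gen : ∀ a < 64, p4 mul3 a ≠ 0 → ∀ t < 64, p2 mul3 t = p4 mul3 a →
    ∃ b < 64, p4 mul3 b ≠ 0 ∧ p4 mul3 (mul3 b t) ≠ 0 := by decide +kernel
theorem t3_sq : ∀ w < 64, p2 mul3 w = 0 → ∃ y < 64, w = p2 mul3 y := by decide +kernel
theorem t3_cen : ∀ w < 64, p2 mul3 w = 0 → ∀ x < 64, mul3 w x = mul3 x w := by decide +kernel
theorem t3_f0 : ∀ a < 64, p4 mul3 a ≠ 0 → ∀ y < 64, p4 mul3 y ≠ 0 →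
    p4 mul3 (mul3 (iv mul3 a) y) = 0 := by decide +kernel
set_option synthInstance.maxHeartbeats 200000 in
set_option synthInstance.maxSize 1000 in
theorem t3_f1 : ∀ a < 64, p4 mul3 a ≠ 0 → ∀ y < 64, p4 mul3 y ≠ 0 → ∀ z < 64, p4 mul3 z ≠ 0 →
    p2 mul3 (mul3 (iv mul3 y) z) = p2 mul3 (mul3 (iv mul3 a) y) →
    p2 mul3 (mul3 (iv mul3 a) z) = 0 := by decide +kernel
theorem t3_A1 : ∀ k < 64, k / 8 % 2 = 0 →
    p4 mul3 k ≠ 0 ∨ ∃ b < 64, p4 mul3 b ≠ 0 ∧ p4 mul3 (mul3 b k) ≠ 0 := by decide +kernel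
theorem t3_A2 : ∀ k < 64,
    (p4 mul3 k ≠ 0 ∨ ∃ b < 64, p4 mul3 b ≠ 0 ∧ p4 mul3 (mul3 b k) ≠ 0) → k / 8 % 2 = 0 := by
  decide +kernel
theorem t3_f2 : ∀ a < 64, p4 mul3 a ≠ 0 → ∀ k < 64,
    p2 mul3 (mul3 (iv mul3 a) (mul3 (mul3 k a) (iv mul3 k))) = 0 → k / 8 % 2 = 0 := by
  decide +kernel
theorem t3_f3 : ∀ a < 64, p4 mul3 a ≠ 0 → ∀ k < 64, k / 8 % 2 ≠ 0 →
    p2 mul3 (mul3 (mul3 (mul3 k a) (iv mul3 k)) a) = 0 := by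
  decide +kernel
theorem t3_am : ∀ x < 64, ∀ y < 64, x / 8 % 2 = 0 → y / 8 % 2 = 0 → mul3 x y / 8 % 2 = 0 := by
  decide +kernel
theorem t3_ai : ∀ x < 64, x / 8 % 2 = 0 → iv mul3 x / 8 % 2 = 0 := by
  decide +kernel

theorem t3_of {H : Type*} [Group H] {K : Subgroup H} {r : ℕ → H}
    (h : IsModelBy mul3 K r) : T3 K := by
  have h0 : mul3 0 0 = 0 := by decide
  have hA : ∀ k < 64, IsA K (r k) ↔ k / 8 % 2 = 0 := by
    intro k hk
    constructor
    · intro h1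
      apply t3_A2 k hk
      rcases h1 with h1 | ⟨b, hb, h1, h2⟩
      · left
        simpa (maxDischargeDepth := 12) only [h.pow_four_eq, h.eq_one_iff h0, h.p4_lt, hk, ne_eq] using h1
      · right
        obtain ⟨b, hbl, rfl⟩ := h.surj b hb
        simp (maxDischargeDepth := 12) only [h.mul_eq, h.pow_four_eq, h.eq_one_iff h0, h.p4_lt, h.lt, hk, hbl, ne_eq] at h1 h2
        exact ⟨b, hbl, h1, h2⟩
    · intro h1
      rcases t3_A1 k hk h1 with h1 | ⟨b, hb, h1, h2⟩
      · left
        simpa (maxDischargeDepth := 12) only [h.pow_four_eq, h.eq_one_iff h0, h.p4_lt, hk, ne_eq] using h1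
      · right
        refine ⟨r b, h.mem b hb, ?_⟩
        simp (maxDischargeDepth := 12) only [h.mul_eq, h.pow_four_eq, h.eq_one_iff h0, h.p4_lt, h.lt, hk, hb, ne_eq]
        exact ⟨h1, h2⟩
  refine ⟨?_, ?_, ?_, ?_, ?_, ?_, ?_, ?_, ?_, ?_, ?_, ?_, ?_, ?_, ?_⟩
  · intro x hxK
    obtain ⟨x, hx, rfl⟩ := h.surj x hxK
    exact h.pow_eight_eq h0 t3_d8 x hx
  · rw [h.ncard_eq (fun x => x ^ 4 ≠ 1) (fun x => p4 mul3 x ≠ 0), t3_c4]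
    intro x hx
    simp (maxDischargeDepth := 12) only [h.pow_four_eq, h.eq_one_iff h0, h.p4_lt, hx, ne_eq]
  · rw [h.ncard_eq (fun x => x ^ 2 = 1) (fun x => p2 mul3 x = 0), t3_c2]
    intro x hx
    simp (maxDischargeDepth := 12) only [h.sq_eq, h.eq_one_iff h0, h.p2_lt, hx]
  · intro a haK t htK
    obtain ⟨a, ha, rfl⟩ := h.surj a haK
    obtain ⟨t, ht, rfl⟩ := h.surj t htK
    simp (maxDischargeDepth := 12) only [h.sq_eq, h.pow_four_eq, h.eq_one_iff h0, h.eq_iff, h.p4_lt, h.p2_lt, ha, ht, ne_eq]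
    intro h1 h2
    obtain ⟨b, hb, h3, h4⟩ := t3_gen a ha h1 t ht h2
    refine ⟨r b, h.mem b hb, ?_⟩
    simp (maxDischargeDepth := 12) only [h.mul_eq, h.pow_four_eq, h.eq_one_iff h0, h.p4_lt, h.lt, ht, hb]
    exact ⟨h3, h4⟩
  · intro w hwK
    obtain ⟨w, hw, rfl⟩ := h.surj w hwK
    simp (maxDischargeDepth := 12) only [h.sq_eq, h.eq_one_iff h0, h.p2_lt, hw]
    intro h1
    obtain ⟨y, hy, h2⟩ := t3_sq w hw h1
    exact ⟨r y, h.mem y hy, by rw [h.sq_eq y hy, ← h2]⟩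
  · intro w hwK x hxK
    obtain ⟨w, hw, rfl⟩ := h.surj w hwK
    obtain ⟨x, hx, rfl⟩ := h.surj x hxK
    simp (maxDischargeDepth := 12) only [h.sq_eq, h.mul_eq, h.eq_one_iff h0, h.eq_iff, h.p2_lt, h.lt, hw, hx]
    intro h1
    exact t3_cen w hw h1 x hx
  · intro a haK y hyK
    obtain ⟨a, ha, rfl⟩ := h.surj a haK
    obtain ⟨y, hy, rfl⟩ := h.surj y hyK
    simp (maxDischargeDepth := 12) only [h.mul_eq, h.inv_eq h0 t3_d8, h.iv_lt, h.pow_four_eq, h.eq_one_iff h0, h.p4_lt,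
      h.lt, ha, hy, ne_eq]
    intro h1 h2
    exact t3_f0 a ha h1 y hy h2
  · intro a haK y hyK z hzK
    obtain ⟨a, ha, rfl⟩ := h.surj a haK
    obtain ⟨y, hy, rfl⟩ := h.surj y hyK
    obtain ⟨z, hz, rfl⟩ := h.surj z hzK
    simp (maxDischargeDepth := 12) only [h.mul_eq, h.inv_eq h0 t3_d8, h.iv_lt, h.pow_four_eq, h.sq_eq, h.p2_lt,
      h.eq_one_iff h0, h.eq_iff, h.p4_lt, h.lt, ha, hy, hz, ne_eq]
    intro h1 h2 h3
    exact t3_f1 a ha h1 y hy h2 z hz h3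
  · intro a haK k hkK
    obtain ⟨a, ha, rfl⟩ := h.surj a haK
    obtain ⟨k, hk, rfl⟩ := h.surj k hkK
    simp (maxDischargeDepth := 12) only [h.mul_eq, h.inv_eq h0 t3_d8, h.iv_lt, h.pow_four_eq, h.sq_eq, h.p2_lt,
      h.eq_one_iff h0, h.p4_lt, h.lt, ha, hk, ne_eq, hA]
    intro h1
    exact t3_f2 a ha h1 k hk
  · intro a haK k hkK
    obtain ⟨a, ha, rfl⟩ := h.surj a haK
    obtain ⟨k, hk, rfl⟩ := h.surj k hkK
    simp (maxDischargeDepth := 12) only [h.mul_eq, h.inv_eq h0 t3_d8, h.iv_lt, h.pow_four_eq, h.sq_eq, h.p2_lt,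
      h.eq_one_iff h0, h.p4_lt, h.lt, ha, hk, ne_eq, hA]
    intro h1
    exact t3_f3 a ha h1 k hk
  · refine ⟨r 1, h.mem 1 (by norm_num), ?_⟩
    rw [h.pow_four_eq 1 (by norm_num), ne_eq, h.eq_one_iff h0 _ (h.p4_lt 1 (by norm_num))]
    decide
  · intro x hxK y hyK
    obtain ⟨x, hx, rfl⟩ := h.surj x hxK
    obtain ⟨y, hy, rfl⟩ := h.surj y hyK
    simp (maxDischargeDepth := 12) only [h.mul_eq, h.lt, hx, hy, hA]
    exact t3_am x hx y hy
  · rw [← h.zero_eq h0, hA 0 (by norm_num)]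
  · intro x hxK
    obtain ⟨x, hx, rfl⟩ := h.surj x hxK
    simp (maxDischargeDepth := 12) only [h.inv_eq h0 t3_d8, h.iv_lt, hx, hA]
    exact t3_ai x hx
  · rw [h.ncard_eq (IsA K) (fun k => k / 8 % 2 = 0) hA]
    decide +kernel


/-- `a, b, c` satisfy exactly one nontrivial relation (in an elementary abelian `2`-group). -/
def RR {α : Type*} (op : α → α → α) (e a b c : α) : Prop :=
  (a = e ∨ b = e ∨ c = e ∨ op a b = e ∨ op a c = e ∨ op b c = e ∨ op (op a b) c = e) ∧
  ¬ (a = e ∧ b = e) ∧ ¬ (a = e ∧ c = e) ∧ ¬ (b = e ∧ c = e) ∧ ¬ (a = e ∧ op b c = e) ∧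
  ¬ (b = e ∧ op a c = e) ∧ ¬ (c = e ∧ op a b = e) ∧ ¬ (op a b = e ∧ op a c = e)

instance (op : ℕ → ℕ → ℕ) (e a b c : ℕ) : Decidable (RR op e a b c) := by
  unfold RR; infer_instance

theorem RR_map {H : Type*} [Group H] (f : ℕ → H)
    (hf : ∀ x < 8, ∀ y < 8, f (x ^^^ y) = f x * f y) (h1 : ∀ x < 8, f x = 1 ↔ x = 0)
    {a b c : ℕ} (ha : a < 8) (hb : b < 8) (hc : c < 8) :
    RR (fun x y => x * y) 1 (f a) (f b) (f c) ↔ RR (fun x y => x ^^^ y) 0 a b c := by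
  unfold RR
  have hab := xor_lt_eight ha hb
  have hac := xor_lt_eight ha hc
  have hbc := xor_lt_eight hb hc
  have habc := xor_lt_eight hab hc
  simp only [← hf _ ha _ hb, ← hf _ ha _ hc, ← hf _ hb _ hc, ← hf _ hab _ hc, h1 _ ha, h1 _ hb,
    h1 _ hc, h1 _ hab, h1 _ hac, h1 _ hbc, h1 _ habc]

/-- The commutator. -/
def cm {H : Type*} [Group H] (x y : H) : H := x * y * x⁻¹ * y⁻¹

/-- Properties of the groups `G₄`, `G₅`. -/
structure T45 {H : Type*} [Group H] (K : Subgroup H) : Prop where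
  e4 : ∀ x ∈ K, x ^ 4 = 1
  c2 : {x | x ∈ K ∧ x ^ 2 = 1}.ncard = 8
  sq2 : ∀ w ∈ K, w ^ 2 = 1 → ∃ y ∈ K, ∃ z ∈ K, w = y ^ 2 * z ^ 2
  cen : ∀ w ∈ K, ∀ x ∈ K, w ^ 2 = 1 → w * x = x * w
  P : ∀ x ∈ K, ∀ y ∈ K, ∀ z ∈ K, x ^ 2 ≠ 1 → y ^ 2 ≠ 1 → z ^ 2 ≠ 1 → (x * y) ^ 2 ≠ 1 →
    (x * z) ^ 2 ≠ 1 → (y * z) ^ 2 ≠ 1 → (x * y * z) ^ 2 ≠ 1 →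
    RR (fun x y => x * y) 1 (cm x y) (cm x z) (cm y z)
  ex : ∃ x ∈ K, ∃ y ∈ K, ∃ z ∈ K, cm x y = 1 ∧ cm x z ≠ 1 ∧ cm y z ≠ 1 ∧ cm x z ≠ cm y z ∧
    x ^ 2 ≠ 1 ∧ y ^ 2 ≠ 1 ∧ z ^ 2 ≠ 1 ∧ (x * y) ^ 2 ≠ 1 ∧
    (x * z) ^ 2 ≠ 1 ∧ (y * z) ^ 2 ≠ 1 ∧ (x * y * z) ^ 2 ≠ 1 ∧
    ∀ S : Subgroup H, x ∈ S → y ∈ S → z ∈ S → (∀ w ∈ K, w ^ 2 = 1 → w ∈ S) → K ≤ S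
  csq : 4 < {x | x ∈ K ∧ ∃ y ∈ K, x = y ^ 2}.ncard

/-- Code of the commutator. -/
def cc (m : ℕ → ℕ → ℕ) (x y : ℕ) : ℕ := m (m (m x y) (iv m x)) (iv m y)

theorem t45_of {H : Type*} [Group H] {β : ℕ → ℕ → ℕ} {K : Subgroup H} {r : ℕ → H}
    (h : IsModelBy (mul45 β) K r) (h0 : mul45 β 0 0 = 0)
    (h4 : ∀ x < 64, p4 (mul45 β) x = 0)
    (d1 : ((Finset.range 64).filter fun x => p2 (mul45 β) x = 0).card = 8)
    (d2 : ∀ w < 64, p2 (mul45 β) w = 0 → ∃ v < 8, ∃ u < 8,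
      w = mul45 β (p2 (mul45 β) (8 * v)) (p2 (mul45 β) (8 * u)))
    (d3 : ∀ w < 64, p2 (mul45 β) w = 0 → ∀ x < 64, mul45 β w x = mul45 β x w)
    (q1 : ∀ x < 64, p2 (mul45 β) x = β (x / 8) (x / 8))
    (q2 : ∀ x < 64, ∀ y < 64, mul45 β x y / 8 = (x / 8) ^^^ (y / 8))
    (q3 : ∀ x < 64, ∀ y < 64, cc (mul45 β) x y = β (x / 8) (y / 8) ^^^ β (y / 8) (x / 8))
    (q4 : ∀ x < 8, ∀ y < 8, mul45 β x y = x ^^^ y)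
    (q5 : ∀ x < 8, ∀ y < 8, β x y < 8)
    (d4 : ∀ x < 8, ∀ y < 8, ∀ z < 8, β x x ≠ 0 ∧ β y y ≠ 0 ∧ β z z ≠ 0 ∧
      β (x ^^^ y) (x ^^^ y) ≠ 0 ∧ β (x ^^^ z) (x ^^^ z) ≠ 0 ∧ β (y ^^^ z) (y ^^^ z) ≠ 0 ∧
      β (x ^^^ y ^^^ z) (x ^^^ y ^^^ z) ≠ 0 →
      RR (fun x y => x ^^^ y) 0 (β x y ^^^ β y x) (β x z ^^^ β z x) (β y z ^^^ β z y))
    (d5 : 4 < ((Finset.range 64).filter fun x => ∃ y ∈ Finset.range 64, x = p2 (mul45 β) y).card)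
    (x y z : ℕ) (hx : x < 64) (hy : y < 64) (hz : z < 64)
    (d6 : cc (mul45 β) x y = 0 ∧ cc (mul45 β) x z ≠ 0 ∧ cc (mul45 β) y z ≠ 0 ∧
      cc (mul45 β) x z ≠ cc (mul45 β) y z)
    (d7 : p2 (mul45 β) x ≠ 0 ∧ p2 (mul45 β) y ≠ 0 ∧ p2 (mul45 β) z ≠ 0 ∧
      p2 (mul45 β) (mul45 β x y) ≠ 0 ∧ p2 (mul45 β) (mul45 β x z) ≠ 0 ∧
      p2 (mul45 β) (mul45 β y z) ≠ 0 ∧ p2 (mul45 β) (mul45 β (mul45 β x y) z) ≠ 0)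
    (d8 : ∀ k < 64, ∃ i < 2, ∃ j < 2, ∃ l < 2, ∃ w < 64, p2 (mul45 β) w = 0 ∧
      k = mul45 β (mul45 β (mul45 β (i * x) (j * y)) (l * z)) w) : T45 K := by
  have h8 : ∀ x < 64, p2 (mul45 β) (p4 (mul45 β) x) = 0 := by
    intro x hx; rw [h4 x hx]; exact h0
  have hcl : ∀ x < 64, ∀ y < 64, cc (mul45 β) x y < 64 := by
    intro x hx y hy
    exact h.lt _ (h.lt _ (h.lt x hx y hy) _ (h.iv_lt x hx)) _ (h.iv_lt y hy)
  have hc : ∀ x < 64, ∀ y < 64, cm (r x) (r y) = r (cc (mul45 β) x y) := by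
    intro x hx y hy
    simp (maxDischargeDepth := 12) only [cm, h.mul_eq, h.inv_eq h0 h8, h.iv_lt,
      h.lt, hx, hy, cc]
  refine ⟨?_, ?_, ?_, ?_, ?_, ?_, ?_⟩
  · intro x hxK
    obtain ⟨x, hx, rfl⟩ := h.surj x hxK
    rw [h.pow_four_eq x hx, h4 x hx, h.zero_eq h0]
  · rw [h.ncard_eq (fun x => x ^ 2 = 1) (fun x => p2 (mul45 β) x = 0), d1]
    intro x hx
    simp (maxDischargeDepth := 12) only [h.sq_eq, h.eq_one_iff h0, h.p2_lt, hx]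
  · intro w hwK
    obtain ⟨w, hw, rfl⟩ := h.surj w hwK
    simp (maxDischargeDepth := 12) only [h.sq_eq, h.eq_one_iff h0, h.p2_lt, hw]
    intro h1
    obtain ⟨v, hv, u, hu, h2⟩ := d2 w hw h1
    have hv' : 8 * v < 64 := by omega
    have hu' : 8 * u < 64 := by omega
    exact ⟨r (8 * v), h.mem _ hv', r (8 * u), h.mem _ hu', by
      rw [h.sq_eq _ hv', h.sq_eq _ hu', h.mul_eq _ _ (h.p2_lt _ hv') (h.p2_lt _ hu'), ← h2]⟩
  · intro w hwK x hxK
    obtain ⟨w, hw, rfl⟩ := h.surj w hwK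
    obtain ⟨x, hx, rfl⟩ := h.surj x hxK
    simp (maxDischargeDepth := 12) only [h.sq_eq, h.mul_eq, h.eq_one_iff h0, h.eq_iff, h.p2_lt,
      h.lt, hw, hx]
    intro h1
    exact d3 w hw h1 x hx
  · intro x hxK y hyK z hzK
    obtain ⟨x, hx, rfl⟩ := h.surj x hxK
    obtain ⟨y, hy, rfl⟩ := h.surj y hyK
    obtain ⟨z, hz, rfl⟩ := h.surj z hzK
    have hx' : x / 8 < 8 := by omega
    have hy' : y / 8 < 8 := by omega
    have hz' : z / 8 < 8 := by omega
    simp (maxDischargeDepth := 12) only [h.sq_eq, h.mul_eq, h.eq_one_iff h0, h.p2_lt, h.lt, hx, hy,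
      hz, ne_eq, hc]
    intro e1 e2 e3 e4 e5 e6 e7
    rw [q3 x hx y hy, q3 x hx z hz, q3 y hy z hz]
    rw [RR_map r]
    · apply d4 _ hx' _ hy' _ hz'
      rw [q1 _ (h.lt _ (h.lt _ hx _ hy) _ hz), q2 _ (h.lt _ hx _ hy) _ hz, q2 _ hx _ hy] at e7
      rw [q1 _ (h.lt _ hx _ hy), q2 _ hx _ hy] at e4
      rw [q1 _ (h.lt _ hx _ hz), q2 _ hx _ hz] at e5
      rw [q1 _ (h.lt _ hy _ hz), q2 _ hy _ hz] at e6
      rw [q1 _ hx] at e1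
      rw [q1 _ hy] at e2
      rw [q1 _ hz] at e3
      exact ⟨e1, e2, e3, e4, e5, e6, e7⟩
    · intro x hx y hy
      rw [h.mul_eq x y (by omega) (by omega), q4 x hx y hy]
    · intro x hx
      exact h.eq_one_iff h0 x (by omega)
    · exact xor_lt_eight (q5 _ hx' _ hy') (q5 _ hy' _ hx')
    · exact xor_lt_eight (q5 _ hx' _ hz') (q5 _ hz' _ hx')
    · exact xor_lt_eight (q5 _ hy' _ hz') (q5 _ hz' _ hy')
  · refine ⟨r x, h.mem x hx, r y, h.mem y hy, r z, h.mem z hz, ?_⟩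
    simp (maxDischargeDepth := 12) only [h.sq_eq, h.mul_eq, h.eq_one_iff h0, h.eq_iff, h.p2_lt,
      h.lt, hx, hy, hz, ne_eq, hc, hcl]
    refine ⟨d6.1, d6.2.1, d6.2.2.1, d6.2.2.2, d7.1, d7.2.1, d7.2.2.1, d7.2.2.2.1, d7.2.2.2.2.1,
      d7.2.2.2.2.2.1, d7.2.2.2.2.2.2, ?_⟩
    intro S hxS hyS hzS hwS k hkK
    obtain ⟨k, hk, rfl⟩ := h.surj k hkK
    have aux : ∀ i < 2, ∀ x < 64, r x ∈ S → i * x < 64 ∧ r (i * x) ∈ S := by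
      intro i hi x hx hxS
      interval_cases i
      · simp [h.zero_eq h0]
      · simpa using ⟨hx, hxS⟩
    obtain ⟨i, hi, j, hj, l, hl, w, hw, hw2, e⟩ := d8 k hk
    have a1 := aux i hi x hx hxS
    have a2 := aux j hj y hy hyS
    have a3 := aux l hl z hz hzS
    have a4 : r w ∈ S := hwS _ (h.mem w hw) (by rw [h.sq_eq w hw, hw2, h.zero_eq h0])
    rw [e, ← h.mul_eq _ _ (h.lt _ (h.lt _ a1.1 _ a2.1) _ a3.1) hw,
      ← h.mul_eq _ _ (h.lt _ a1.1 _ a2.1) a3.1, ← h.mul_eq _ _ a1.1 a2.1]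
    exact S.mul_mem (S.mul_mem (S.mul_mem a1.2 a2.2) a3.2) a4
  · rw [h.ncard_eq (fun x => ∃ y ∈ K, x = y ^ 2) (fun x => ∃ y ∈ Finset.range 64, x = p2 (mul45 β) y)]
    · exact d5
    · intro x hx
      constructor
      · rintro ⟨y, hyK, e⟩
        obtain ⟨y, hy, rfl⟩ := h.surj y hyK
        rw [h.sq_eq y hy, h.eq_iff x _ hx (h.p2_lt y hy)] at e
        exact ⟨y, Finset.mem_range.2 hy, e⟩
      · rintro ⟨y, hy, e⟩
        have hy := Finset.mem_range.1 hy
        exact ⟨r y, h.mem y hy, by rw [h.sq_eq y hy, e]⟩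

set_option synthInstance.maxHeartbeats 200000 in
set_option synthInstance.maxSize 1000 in
theorem t45_of_four {H : Type*} [Group H] {K : Subgroup H} {r : ℕ → H}
    (h : IsModelBy (mul45 beta4) K r) : T45 K :=
  t45_of h (by decide +kernel) (by decide +kernel) (by decide +kernel) (by decide +kernel)
    (by decide +kernel) (by decide +kernel) (by decide +kernel) (by decide +kernel)
    (by decide +kernel) (by decide +kernel) (by decide +kernel) (by decide +kernel)
    8 32 16 (by norm_num) (by norm_num) (by norm_num) (by decide +kernel) (by decide +kernel)
    (by decide +kernel)

set_option synthInstance.maxHeartbeats 200000 in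
set_option synthInstance.maxSize 1000 in
theorem t45_of_five {H : Type*} [Group H] {K : Subgroup H} {r : ℕ → H}
    (h : IsModelBy (mul45 beta5) K r) : T45 K :=
  t45_of h (by decide +kernel) (by decide +kernel) (by decide +kernel) (by decide +kernel)
    (by decide +kernel) (by decide +kernel) (by decide +kernel) (by decide +kernel)
    (by decide +kernel) (by decide +kernel) (by decide +kernel) (by decide +kernel)
    8 48 16 (by norm_num) (by norm_num) (by norm_num) (by decide +kernel) (by decide +kernel)
    (by decide +kernel)


/-! ### Groups of order 128 -/

theorem ext_two {H : Type*} [Group H] [Finite H] (L : Subgroup H) (t : H)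
    (hn : ∀ x ∈ L, t * x * t⁻¹ ∈ L) (h2 : t * t ∈ L) (ht : t ∉ L) :
    ∃ M : Subgroup H, (∀ x, x ∈ M ↔ x ∈ L ∨ x * t ∈ L) ∧ Nat.card M = 2 * Nat.card L := by
  have hn' : ∀ x ∈ L, t⁻¹ * x * t ∈ L := by
    intro x hx
    have : t⁻¹ * x * t = (t * t)⁻¹ * (t * x * t⁻¹) * (t * t) := by group
    rw [this]
    exact L.mul_mem (L.mul_mem (L.inv_mem h2) (hn x hx)) h2
  let M : Subgroup H :=
    { carrier := {x | x ∈ L ∨ x * t ∈ L}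
      one_mem' := Or.inl L.one_mem
      mul_mem' := by
        rintro x y (hx | hx) (hy | hy)
        · exact Or.inl (L.mul_mem hx hy)
        · right; rw [mul_assoc]; exact L.mul_mem hx hy
        · right
          have : x * y * t = (x * t) * (t⁻¹ * y * t) := by group
          rw [this]; exact L.mul_mem hx (hn' y hy)
        · left
          have : x * y = (x * t) * (t⁻¹ * (y * t) * t) * (t * t)⁻¹ := by group
          rw [this]; exact L.mul_mem (L.mul_mem hx (hn' _ hy)) (L.inv_mem h2)
      inv_mem' := by
        rintro x (hx | hx)
        · exact Or.inl (L.inv_mem hx)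
        · right
          have : x⁻¹ * t = (t * (x * t)⁻¹ * t⁻¹) * (t * t) := by group
          rw [this]; exact L.mul_mem (hn _ (L.inv_mem hx)) h2 }
  refine ⟨M, fun x => Iff.rfl, ?_⟩
  have e1 : (M : Set H) = (L : Set H) ∪ (fun x => x * t⁻¹) '' (L : Set H) := by
    ext x
    constructor
    · rintro (hx | hx)
      · exact Or.inl hx
      · exact Or.inr ⟨x * t, hx, by simp⟩
    · rintro (hx | ⟨y, hy, rfl⟩)
      · exact Or.inl hx
      · right; simpa using hy
  have hd : Disjoint (L : Set H) ((fun x => x * t⁻¹) '' (L : Set H)) := by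
    rw [Set.disjoint_left]
    rintro _ hx ⟨y, hy, rfl⟩
    have h1 : (y * t⁻¹)⁻¹ * y ∈ L := L.mul_mem (L.inv_mem hx) hy
    simp at h1
    exact ht h1
  have h3 : (M : Set H).ncard = 2 * (L : Set H).ncard := by
    rw [e1, Set.ncard_union_eq hd, Set.ncard_image_of_injective _ (mul_left_injective _), two_mul]
  exact h3

set_option linter.unusedSectionVars false
section
variable {H : Type*} [Group H] [Finite H]

theorem index_eq_two (hH : Nat.card H = 128) (K : Subgroup H) (hK : Nat.card K = 64) :
    K.index = 2 := by
  have := K.card_mul_index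
  rw [hK, hH] at this
  omega

theorem sq_mem64 (hH : Nat.card H = 128) (K : Subgroup H) (hK : Nat.card K = 64) (h : H) :
    h ^ 2 ∈ K := by
  rw [sq]; exact Subgroup.mul_self_mem_of_index_two (index_eq_two hH K hK) h

theorem conj_mem64 (hH : Nat.card H = 128) (K : Subgroup H) (hK : Nat.card K = 64) (t h : H)
    (hh : h ∈ K) : t * h * t⁻¹ ∈ K :=
  (Subgroup.normal_of_index_eq_two (index_eq_two hH K hK)).conj_mem h hh t

theorem mul_mem64 (hH : Nat.card H = 128) (K : Subgroup H) (hK : Nat.card K = 64) (x y : H) :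
    x * y ∈ K ↔ (x ∈ K ↔ y ∈ K) :=
  Subgroup.mul_mem_iff_of_index_two (index_eq_two hH K hK)

theorem exists_not_mem64 (hH : Nat.card H = 128) (K : Subgroup H) (hK : Nat.card K = 64) :
    ∃ t, t ∉ K := by
  by_contra! h
  have : K = ⊤ := by ext x; simp [h x]
  rw [this, Subgroup.card_top] at hK
  omega

theorem exists_mem64 (hH : Nat.card H = 128)
    (h8 : ∀ K : Subgroup H, Nat.card K = 64 → ∀ x ∈ K, x ^ 8 = 1) (h : H) :
    ∃ K : Subgroup H, Nat.card K = 64 ∧ h ∈ K := by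
  have : Fact (Nat.Prime 2) := ⟨Nat.prime_two⟩
  obtain ⟨K, hK⟩ := Sylow.exists_subgroup_card_pow_prime (G := H) 2 (n := 6)
    (by rw [hH]; norm_num)
  have h16 : h ^ 16 = 1 := by
    have := h8 K (by rw [hK]; norm_num) _ (sq_mem64 hH K (by rw [hK]; norm_num) h)
    rwa [← pow_mul] at this
  have hd : orderOf h ∣ 2 ^ 4 := orderOf_dvd_of_pow_eq_one (by simpa using h16)
  obtain ⟨n, hn, hn'⟩ := (Nat.dvd_prime_pow Nat.prime_two).1 hd
  obtain ⟨M, hM, hle⟩ := Sylow.exists_subgroup_card_pow_prime_le (G := H) 2 (n := n) (m := 6)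
    (by rw [hH]; norm_num) (Subgroup.zpowers h) (by rw [Nat.card_zpowers, hn']) (by omega)
  exact ⟨M, by rw [hM]; norm_num, hle (Subgroup.mem_zpowers h)⟩

theorem pow_eight (hH : Nat.card H = 128)
    (h8 : ∀ K : Subgroup H, Nat.card K = 64 → ∀ x ∈ K, x ^ 8 = 1) (h : H) : h ^ 8 = 1 := by
  obtain ⟨K, hK, hh⟩ := exists_mem64 hH h8 h
  exact h8 K hK h hh

theorem exists64 (hH : Nat.card H = 128) : ∃ K : Subgroup H, Nat.card K = 64 := by
  have : Fact (Nat.Prime 2) := ⟨Nat.prime_two⟩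
  obtain ⟨K, hK⟩ := Sylow.exists_subgroup_card_pow_prime (G := H) 2 (n := 6)
    (by rw [hH]; norm_num)
  exact ⟨K, by rw [hK]; norm_num⟩

/-- If `A ⊆ B` are sets of the same cardinality, then `B ⊆ A`. -/
theorem mem_of_ncard {A B : Set H} (h : A ⊆ B) (hc : B.ncard ≤ A.ncard) {x : H} (hx : x ∈ B) :
    x ∈ A := by
  rw [Set.eq_of_subset_of_ncard_le h hc (Set.toFinite B)]; exact hx

theorem conj_pow_eq (t x : H) (n : ℕ) : (t * x * t⁻¹) ^ n = t * x ^ n * t⁻¹ := conj_pow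

theorem conj_pow_one (t x : H) (n : ℕ) : (t * x * t⁻¹) ^ n = 1 ↔ x ^ n = 1 := by
  rw [conj_pow]
  constructor
  · intro h
    have : t⁻¹ * (t * x ^ n * t⁻¹) * t = 1 := by rw [h]; group
    simpa [mul_assoc] using this
  · intro h; rw [h]; group
end

theorem case12 {H : Type*} [Group H] [Finite H] (hH : Nat.card H = 128)
    (hall : ∀ K : Subgroup H, Nat.card K = 64 → T12 K ∨ T3 K ∨ T45 K)
    (h8 : ∀ h : H, h ^ 8 = 1)
    (K : Subgroup H) (hK : Nat.card K = 64) (hT : T12 K) : False := by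
  obtain ⟨t, ht⟩ := exists_not_mem64 hH K hK
  have ht2 : t ^ 2 ∈ K := sq_mem64 hH K hK t
  -- choice of `v`
  obtain ⟨v, hvK, hv2, hv1, hvt, hv⟩ : ∃ v ∈ K, v ^ 2 = 1 ∧ v ≠ 1 ∧ t * v * t⁻¹ = v ∧
      (t ^ 4 = v ∨ t ^ 2 = v ∨ t ^ 2 = 1) := by
    by_cases c4 : t ^ 4 = 1
    · by_cases c2 : t ^ 2 = 1
      · obtain ⟨u, hu, hu1⟩ : ∃ u, u ∈ {x | x ∈ K ∧ x ^ 2 = 1} ∧ u ≠ 1 := by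
          apply Set.exists_ne_of_one_lt_ncard
          rw [hT.c2]; norm_num
        obtain ⟨huK, hu2⟩ := hu
        by_cases cu : t * u * t⁻¹ = u
        · exact ⟨u, huK, hu2, hu1, cu, Or.inr (Or.inr c2)⟩
        · have h1 : t * u * t⁻¹ ∈ K := conj_mem64 hH K hK t u huK
          have h2 : (t * u * t⁻¹) ^ 2 = 1 := (conj_pow_one t u 2).2 hu2
          have h3 := hT.com _ huK _ h1 hu2 h2
          refine ⟨u * (t * u * t⁻¹), K.mul_mem huK h1, ?_, ?_, ?_, Or.inr (Or.inr c2)⟩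
          · rw [(show Commute u (t * u * t⁻¹) from h3).mul_pow, hu2, h2, one_mul]
          · intro h4
            apply cu
            have h5 := eq_inv_of_mul_eq_one_right h4
            rw [h5]
            rw [inv_eq_iff_mul_eq_one, ← sq, hu2]
          · have h5 : t * (u * (t * u * t⁻¹)) * t⁻¹ =
                (t * u * t⁻¹) * (t ^ 2 * u * (t ^ 2)⁻¹) := by rw [sq]; group
            rw [h5, c2, h3]; group
      · refine ⟨t ^ 2, ht2, ?_, c2, by group, Or.inr (Or.inl rfl)⟩
        rw [← pow_mul]; exact c4
    · refine ⟨t ^ 4, ?_, ?_, c4, by group, Or.inl rfl⟩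
      · rw [show 4 = 2 * 2 by norm_num, pow_mul]; exact K.pow_mem ht2 2
      · rw [← pow_mul]; exact h8 t
  obtain ⟨a, haK, hav⟩ := hT.surj v hvK hv2 hv1
  let S : Subgroup H :=
    { carrier := {x | x ∈ K ∧ x ^ 4 = 1}
      one_mem' := ⟨K.one_mem, one_pow 4⟩
      mul_mem' := fun hx hy => ⟨K.mul_mem hx.1 hy.1, hT.s4 _ hx.1 _ hy.1 hx.2 hy.2⟩
      inv_mem' := fun hx => ⟨K.inv_mem hx.1, by rw [inv_pow, hx.2, inv_one]⟩ }
  have hS : ∀ x, x ∈ S ↔ x ∈ K ∧ x ^ 4 = 1 := fun x => Iff.rfl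
  have hSc : Nat.card S = 16 := hT.c4
  have hSn : ∀ s, ∀ x ∈ S, s * x * s⁻¹ ∈ S := by
    intro s x hx
    exact ⟨conj_mem64 hH K hK s x hx.1, (conj_pow_one s x 4).2 hx.2⟩
  have hSq : ∀ x, x * x ∈ S := by
    intro x
    rw [← sq]
    exact ⟨sq_mem64 hH K hK x, by rw [← pow_mul]; exact h8 x⟩
  have haS : a ∉ S := fun h => hv1 (by rw [← hav]; exact h.2)
  obtain ⟨L, hL, hLc⟩ := ext_two S a (hSn a) (hSq a) haS
  have hSL : ∀ x ∈ S, x ∈ L := fun x hx => (hL x).2 (Or.inl hx)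
  have hLK : ∀ x ∈ L, x ∈ K := by
    intro x hx
    rcases (hL x).1 hx with h | h
    · exact h.1
    · exact (K.mul_mem_cancel_right haK).1 h.1
  have haL : a ∈ L := (hL a).2 (Or.inr (hSq a))
  have htL : t ∉ L := fun h => ht (hLK t h)
  have hLn : ∀ x ∈ L, t * x * t⁻¹ ∈ L := by
    intro x hx
    rcases (hL x).1 hx with h | h
    · exact hSL _ (hSn t x h)
    · refine (hL _).2 (Or.inr ?_)
      have h1 : t * x * t⁻¹ * a = (t * (x * a) * t⁻¹) * ((t * a⁻¹ * t⁻¹) * a) := by group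
      rw [h1]
      refine S.mul_mem (hSn t _ h) ?_
      have h2 := conj_mem64 hH K hK t _ (K.inv_mem haK)
      refine ⟨K.mul_mem h2 haK, hT.inj _ h2 _ haK ?_⟩
      rw [conj_pow, inv_pow, hav]
      have h3 : v⁻¹ = v := by rw [inv_eq_iff_mul_eq_one, ← sq, hv2]
      rw [h3, hvt]
  obtain ⟨M, hM, hMc⟩ := ext_two L t hLn (hSL _ (hSq t)) htL
  have hMc' : Nat.card M = 64 := by rw [hMc, hLc, hSc]
  have hLM : ∀ x ∈ L, x ∈ M := fun x hx => (hM x).2 (Or.inl hx)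
  have haM := hLM a haL
  have htM : t ∈ M := (hM t).2 (Or.inr (hSL _ (hSq t)))
  have hat : a * t ∉ K := fun h => ht ((K.mul_mem_cancel_left haK).1 h)
  have ha4 : a ^ 4 ≠ 1 := by rw [hav]; exact hv1
  rcases hall M hMc' with hM' | hM' | hM'
  · have key : ∀ x ∈ M, x ^ 4 = 1 → x ∈ K := by
      intro x hx hx4
      refine (mem_of_ncard (A := {x | x ∈ K ∧ x ^ 4 = 1}) (B := {x | x ∈ M ∧ x ^ 4 = 1})
        ?_ ?_ ⟨hx, hx4⟩).1
      · rintro y hy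
        exact ⟨hLM y (hSL y hy), hy.2⟩
      · rw [hT.c4, hM'.c4]
    rcases hv with h | h | h
    · exact hat (key _ (M.mul_mem haM htM) (hM'.inj a haM t htM (by rw [hav, h])))
    · exact ht (key t htM (by rw [show 4 = 2 * 2 by norm_num, pow_mul, h, hv2]))
    · exact ht (key t htM (by rw [show 4 = 2 * 2 by norm_num, pow_mul, h, one_pow]))
  · have key : ∀ x ∈ M, x ^ 4 ≠ 1 → x ∈ K := by
      intro x hx hx4
      refine hLK x (mem_of_ncard (A := (L : Set H) \ (S : Set H)) (B := {x | x ∈ M ∧ x ^ 4 ≠ 1})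
        ?_ ?_ ⟨hx, hx4⟩).1
      · rintro y ⟨hyL, hyS⟩
        exact ⟨hLM y hyL, fun h => hyS ⟨hLK y hyL, h⟩⟩
      · rw [hM'.c4, Set.ncard_sdiff hSL]
        have e1 : (L : Set H).ncard = 32 := by
          have : Nat.card L = 32 := by rw [hLc, hSc]
          exact this
        have e2 : (S : Set H).ncard = 16 := hSc
        rw [e1, e2]
    rcases hv with h | h | h
    · exact ht (key t htM (by rw [h]; exact hv1))
    · obtain ⟨b, hb, hb4, hbt⟩ := hM'.gen a haM t htM ha4 (by rw [hav, h])
      have hbK := key b hb hb4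
      exact ht ((K.mul_mem_cancel_left hbK).1 (key _ (M.mul_mem hb htM) hbt))
    · refine ht (mem_of_ncard (A := {x | x ∈ K ∧ x ^ 2 = 1}) (B := {x | x ∈ M ∧ x ^ 2 = 1})
        ?_ ?_ ⟨htM, h⟩).1
      · rintro y ⟨hy, hy2⟩
        refine ⟨hLM y (hSL y ⟨hy, ?_⟩), hy2⟩
        rw [show 4 = 2 * 2 by norm_num, pow_mul, hy2, one_pow]
      · rw [hT.c2, hM'.c2]
  · exact ha4 (hM'.e4 a haM)


theorem case3 {H : Type*} [Group H] [Finite H] (hH : Nat.card H = 128)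
    (hall : ∀ K : Subgroup H, Nat.card K = 64 → T3 K ∨ T45 K)
    (hmem : ∀ h : H, ∃ K : Subgroup H, Nat.card K = 64 ∧ h ∈ K)
    (K : Subgroup H) (hK : Nat.card K = 64) (hT : T3 K) : False := by
  have hall3 : ∀ M : Subgroup H, Nat.card M = 64 → T3 M := by
    intro M hM
    rcases hall M hM with h | h
    · exact h
    · exfalso
      have h1 : {x | x ∈ M ∧ x ^ 2 = 1} ⊆ {x | x ∈ K ∧ x ^ 2 = 1} := by
        rintro w ⟨hw, hw2⟩
        obtain ⟨y, hy, z, hz, e⟩ := h.sq2 w hw hw2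
        refine ⟨?_, hw2⟩
        rw [e]
        exact K.mul_mem (sq_mem64 hH K hK y) (sq_mem64 hH K hK z)
      have h2 := Set.ncard_le_ncard h1 (Set.toFinite _)
      rw [h.c2, hT.c2] at h2
      omega
  have hcen : ∀ w ∈ K, w ^ 2 = 1 → ∀ x, w * x = x * w := by
    intro w hw hw2 x
    obtain ⟨M, hM, hx⟩ := hmem x
    obtain ⟨y, hy, e⟩ := hT.sq w hw hw2
    refine (hall3 M hM).cen w ?_ x hx hw2
    rw [e]; exact sq_mem64 hH M hM y
  obtain ⟨a, ha, ha4⟩ := hT.ex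
  have claim1 : ∀ t, t ∉ K → IsA K (t ^ 2) := by
    intro t ht
    have hy := conj_mem64 hH K hK t a ha
    have hz := conj_mem64 hH K hK t _ hy
    have hy4 : (t * a * t⁻¹) ^ 4 ≠ 1 := fun h => ha4 ((conj_pow_one _ _ _).1 h)
    have hz4 : (t * (t * a * t⁻¹) * t⁻¹) ^ 4 ≠ 1 := fun h => hy4 ((conj_pow_one _ _ _).1 h)
    have h0 := hT.f0 a ha _ hy ha4 hy4
    have h1 := hT.f1 a ha _ hy _ hz ha4 hy4 hz4 (by
      have e : (t * a * t⁻¹)⁻¹ * (t * (t * a * t⁻¹) * t⁻¹) = t * (a⁻¹ * (t * a * t⁻¹)) * t⁻¹ := by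
        group
      rw [e, conj_pow, ← hcen _ (K.pow_mem (K.mul_mem (K.inv_mem ha) hy) 2) (by
        rw [← pow_mul]; exact h0) t, mul_inv_cancel_right])
    refine hT.f2 a ha (t ^ 2) (sq_mem64 hH K hK t) ha4 ?_
    have e : t ^ 2 * a * (t ^ 2)⁻¹ = t * (t * a * t⁻¹) * t⁻¹ := by rw [sq]; group
    rw [e]; exact h1
  let A : Subgroup H :=
    { carrier := {x | x ∈ K ∧ IsA K x}
      one_mem' := ⟨K.one_mem, hT.aone⟩
      mul_mem' := fun hx hy => ⟨K.mul_mem hx.1 hy.1, hT.amul _ hx.1 _ hy.1 hx.2 hy.2⟩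
      inv_mem' := fun hx => ⟨K.inv_mem hx.1, hT.ainv _ hx.1 hx.2⟩ }
  have hAc : Nat.card A = 32 := hT.cA
  have hAn : ∀ t, ∀ x ∈ A, t * x * t⁻¹ ∈ A := by
    rintro t x ⟨hx, hxA⟩
    refine ⟨conj_mem64 hH K hK t x hx, ?_⟩
    rcases hxA with h | ⟨b, hb, h1, h2⟩
    · left; exact fun h' => h ((conj_pow_one _ _ _).1 h')
    · right
      refine ⟨t * b * t⁻¹, conj_mem64 hH K hK t b hb, fun h' => h1 ((conj_pow_one _ _ _).1 h'), ?_⟩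
      rw [conj_mul]
      exact fun h' => h2 ((conj_pow_one _ _ _).1 h')
  have claim2 : ∀ t, t ∉ K → (t * a * t⁻¹ * a) ^ 2 = 1 := by
    intro t ht
    obtain ⟨M, hM, hMc⟩ := ext_two A t (hAn t)
      (by rw [← sq]; exact ⟨sq_mem64 hH K hK t, claim1 t ht⟩) (fun h => ht h.1)
    have hMc' : Nat.card M = 64 := by rw [hMc, hAc]
    have hM3 := hall3 M hMc'
    have haM : a ∈ M := (hM a).2 (Or.inl ⟨ha, Or.inl ha4⟩)
    have htM : t ∈ M := (hM t).2 (Or.inr (by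
      rw [← sq]; exact ⟨sq_mem64 hH K hK t, claim1 t ht⟩))
    have key : ∀ x ∈ M, x ^ 4 ≠ 1 → x ∈ K := by
      intro x hx hx4
      refine (mem_of_ncard (A := {x | x ∈ K ∧ x ^ 4 ≠ 1}) (B := {x | x ∈ M ∧ x ^ 4 ≠ 1})
        ?_ ?_ ⟨hx, hx4⟩).1
      · rintro y ⟨hy, hy4⟩
        exact ⟨(hM y).2 (Or.inl ⟨hy, Or.inl hy4⟩), hy4⟩
      · rw [hT.c4, hM3.c4]
    refine hM3.f3 a haM t htM ha4 ?_
    rintro (h | ⟨b, hb, h1, h2⟩)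
    · exact ht (key t htM h)
    · exact ht ((K.mul_mem_cancel_left (key b hb h1)).1 (key _ (M.mul_mem hb htM) h2))
  obtain ⟨t, ht⟩ := exists_not_mem64 hH K hK
  obtain ⟨s, hs, hsA⟩ : ∃ s ∈ K, ¬ IsA K s := by
    by_contra! h
    have h1 : K ≤ A := fun x hx => ⟨hx, h x hx⟩
    have h2 := Subgroup.card_le_of_le h1
    omega
  have hst : s * t ∉ K := fun h => ht ((K.mul_mem_cancel_left hs).1 h)
  have h1 := claim2 t ht
  have h2 := hT.f3 a ha s hs ha4 hsA
  have h3 := claim2 _ hst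
  have c1 := hcen _ (K.mul_mem (conj_mem64 hH K hK t a ha) ha) h1
  have c2 := hcen _ (K.mul_mem (conj_mem64 hH K hK s a ha) ha) h2
  have e1 : t * a * t⁻¹ = (t * a * t⁻¹ * a) * a⁻¹ := by group
  have e2 : s * a * s⁻¹ = (s * a * s⁻¹ * a) * a⁻¹ := by group
  generalize t * a * t⁻¹ * a = w1 at *
  generalize s * a * s⁻¹ * a = w2 at *
  have i2 : w2⁻¹ = w2 := by rw [inv_eq_iff_mul_eq_one, ← sq, h2]
  have e3 : s * t * a * (s * t)⁻¹ * a = w1 * (w2 * a ^ 2) := by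
    calc s * t * a * (s * t)⁻¹ * a = s * (t * a * t⁻¹) * s⁻¹ * a := by group
      _ = s * (w1 * a⁻¹) * s⁻¹ * a := by rw [e1]
      _ = (s * w1) * a⁻¹ * s⁻¹ * a := by group
      _ = (w1 * s) * a⁻¹ * s⁻¹ * a := by rw [c1 s]
      _ = w1 * (s * a * s⁻¹)⁻¹ * a := by group
      _ = w1 * (w2 * a⁻¹)⁻¹ * a := by rw [e2]
      _ = w1 * (a * w2⁻¹) * a := by group
      _ = w1 * (w2 * a) * a := by rw [i2, c2 a]
      _ = w1 * (w2 * a ^ 2) := by rw [sq]; group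
  rw [e3, (show Commute w1 _ from c1 _).mul_pow, (show Commute w2 _ from c2 _).mul_pow, h1, h2,
    one_mul, one_mul, ← pow_mul] at h3
  exact ha4 h3


/-! Groups in which all squares are of order dividing two and elements of order two are central. -/

section
variable {H : Type*} [Group H]

theorem cm_sq (h4 : ∀ h : H, (h ^ 2) ^ 2 = 1) (hc : ∀ w x : H, w ^ 2 = 1 → w * x = x * w)
    (x y : H) : cm x y ^ 2 = 1 := by
  have e : cm x y = x ^ 2 * ((x⁻¹ * y) ^ 2 * (y⁻¹) ^ 2) := by
    unfold cm; simp only [sq]; group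
  rw [e, (show Commute (x ^ 2) _ from hc _ _ (h4 x)).mul_pow,
    (show Commute ((x⁻¹ * y) ^ 2) _ from hc _ _ (h4 _)).mul_pow, h4, h4, h4, one_mul, one_mul]

theorem cm_mul_left (h4 : ∀ h : H, (h ^ 2) ^ 2 = 1)
    (hc : ∀ w x : H, w ^ 2 = 1 → w * x = x * w) (x y z : H) :
    cm (x * y) z = cm x z * cm y z := by
  have e : cm (x * y) z = x * cm y z * (z * x⁻¹ * z⁻¹) := by unfold cm; group
  rw [e, ← hc _ x (cm_sq h4 hc y z), hc (cm x z) _ (cm_sq h4 hc x z)]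
  unfold cm; group

theorem cm_self (x : H) : cm x x = 1 := by unfold cm; group

theorem cm_symm (h4 : ∀ h : H, (h ^ 2) ^ 2 = 1)
    (hc : ∀ w x : H, w ^ 2 = 1 → w * x = x * w) (x y : H) : cm x y = cm y x := by
  have h1 : cm x y * cm y x = 1 := by unfold cm; group
  have h2 := cm_sq h4 hc x y
  rw [sq] at h2
  exact mul_left_cancel (h2.trans h1.symm)

theorem cm_mul_right (h4 : ∀ h : H, (h ^ 2) ^ 2 = 1)
    (hc : ∀ w x : H, w ^ 2 = 1 → w * x = x * w) (x y z : H) :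
    cm x (y * z) = cm x y * cm x z := by
  rw [cm_symm h4 hc x, cm_mul_left h4 hc, cm_symm h4 hc x y, cm_symm h4 hc x z]

theorem cm_cen (hc : ∀ w x : H, w ^ 2 = 1 → w * x = x * w) (x w : H) (hw : w ^ 2 = 1) :
    cm x w = 1 := by
  unfold cm; rw [← hc w x hw]; group

theorem sq_mul_eq (x y : H) (hc : ∀ w x : H, w ^ 2 = 1 → w * x = x * w)
    (h4 : ∀ h : H, (h ^ 2) ^ 2 = 1) : (x * y) ^ 2 = x ^ 2 * y ^ 2 * cm y x := by
  rw [← hc (cm y x) _ (cm_sq h4 hc y x)]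
  have e : (x * y) ^ 2 = x * (cm y x * (x * y * y)) := by unfold cm; simp only [sq]; group
  rw [e, ← mul_assoc, ← hc (cm y x) x (cm_sq h4 hc y x)]
  simp only [sq]; group

/-- Coordinates on an elementary abelian group of order eight. -/
def om (a b e : H) (x : ℕ) : H := a ^ (x % 2) * b ^ (x / 2 % 2) * e ^ (x / 4 % 2)

theorem om_mul (hc : ∀ w x : H, w ^ 2 = 1 → w * x = x * w) (a b e : H) (ha : a ^ 2 = 1)
    (hb : b ^ 2 = 1) (he : e ^ 2 = 1) :
    ∀ x < 8, ∀ y < 8, om a b e (x ^^^ y) = om a b e x * om a b e y := by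
  intro x hx y hy
  have hbit : ∀ x < 8, ∀ y < 8, (x ^^^ y) % 2 = (x % 2 + y % 2) % 2 ∧
      (x ^^^ y) / 2 % 2 = (x / 2 % 2 + y / 2 % 2) % 2 ∧
      (x ^^^ y) / 4 % 2 = (x / 4 % 2 + y / 4 % 2) % 2 := by decide
  obtain ⟨h1, h2, h3⟩ := hbit x hx y hy
  unfold om
  rw [h1, h2, h3, ← pow_eq_pow_mod _ ha, ← pow_eq_pow_mod _ hb, ← pow_eq_pow_mod _ he,
    pow_add, pow_add, pow_add]
  have c1 : ∀ n, ∀ z, Commute (b ^ n) z := fun n z => (show Commute b z from hc b z hb).pow_left n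
  have c2 : ∀ n, ∀ z, Commute (e ^ n) z := fun n z => (show Commute e z from hc e z he).pow_left n
  generalize a ^ (x % 2) = a1
  generalize a ^ (y % 2) = a2
  have d1 := (c1 (x / 2 % 2) a2).eq
  have d2 := (c2 (x / 4 % 2) (a2 * b ^ (y / 2 % 2))).eq
  generalize b ^ (x / 2 % 2) = b1 at *
  generalize b ^ (y / 2 % 2) = b2 at *
  generalize e ^ (x / 4 % 2) = e1 at *
  generalize e ^ (y / 4 % 2) = e2 at *
  calc a1 * a2 * (b1 * b2) * (e1 * e2) = a1 * (a2 * b1) * b2 * e1 * e2 := by group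
    _ = a1 * (b1 * a2) * b2 * e1 * e2 := by rw [d1]
    _ = a1 * b1 * ((a2 * b2) * e1) * e2 := by group
    _ = a1 * b1 * (e1 * (a2 * b2)) * e2 := by rw [d2]
    _ = a1 * b1 * e1 * (a2 * b2 * e2) := by group

theorem om_one (a b e : H) (hb : b ^ 2 = 1) (he : e ^ 2 = 1)
    (ha1 : a ≠ 1) (hb1 : b ≠ 1) (hab : a ≠ b) (he1 : e ≠ 1) (hea : e ≠ a) (heb : e ≠ b)
    (heab : e ≠ a * b) : ∀ x < 8, om a b e x = 1 ↔ x = 0 := by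
  have hb' : b⁻¹ = b := by rw [inv_eq_iff_mul_eq_one, ← sq, hb]
  have he' : e⁻¹ = e := by rw [inv_eq_iff_mul_eq_one, ← sq, he]
  intro x hx
  interval_cases x <;> simp [om, mul_eq_one_iff_eq_inv, hb', he', ha1, hb1, hab, he1, hea.symm,
    heb.symm, heab.symm]

theorem om_surj [Finite H] (hc : ∀ w x : H, w ^ 2 = 1 → w * x = x * w) (a b e : H)
    (ha : a ^ 2 = 1) (hb : b ^ 2 = 1) (he : e ^ 2 = 1) (h1 : ∀ x < 8, om a b e x = 1 ↔ x = 0)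
    (hcard : {w : H | w ^ 2 = 1}.ncard = 8) (w : H) (hw : w ^ 2 = 1) :
    ∃ x < 8, om a b e x = w := by
  have hm := om_mul hc a b e ha hb he
  have hsq : ∀ x < 8, om a b e x ^ 2 = 1 := by
    intro x hx
    rw [sq, ← hm x hx x hx, Nat.xor_self, h1 0 (by norm_num)]
  have h2 : (om a b e '' ((Finset.range 8 : Finset ℕ) : Set ℕ)).ncard = 8 := by
    rw [Set.InjOn.ncard_image, Set.ncard_coe_finset, Finset.card_range]
    intro x hx y hy hxy
    have hx : x < 8 := by simpa using hx
    have hy : y < 8 := by simpa using hy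
    have h3 : om a b e (x ^^^ y) = 1 := by rw [hm x hx y hy, hxy, ← sq, hsq y hy]
    rw [h1 _ (xor_lt_eight hx hy)] at h3
    exact Nat.xor_eq_zero_iff.1 h3
  obtain ⟨x, hx, h⟩ := mem_of_ncard (A := om a b e '' ((Finset.range 8 : Finset ℕ) : Set ℕ))
    (B := {w : H | w ^ 2 = 1}) (by
      rintro _ ⟨x, hx, rfl⟩
      exact hsq x (by simpa using hx)) (by rw [hcard, h2]) hw
  exact ⟨x, by simpa using hx, h⟩
end

set_option synthInstance.maxHeartbeats 200000 in
set_option synthInstance.maxSize 1000 in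
/-- The combinatorial core of the last case. -/
theorem core45 : ∀ i < 8, ∀ j < 8, ∀ k < 8, RR (fun x y => x ^^^ y) 0 0 i j ∧
    RR (fun x y => x ^^^ y) 0 0 (1 ^^^ i) (2 ^^^ j) ∧
    RR (fun x y => x ^^^ y) 0 2 j k ∧ RR (fun x y => x ^^^ y) 0 2 j (i ^^^ k) ∧
    RR (fun x y => x ^^^ y) 0 2 j (1 ^^^ k) → i < 4 ∧ j < 4 ∧ k < 4 := by
  decide +kernel


theorem hyper45 {H : Type*} [Group H] [Finite H]
    (hall : ∀ K : Subgroup H, Nat.card K = 64 → T45 K)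
    (h4 : ∀ h : H, (h ^ 2) ^ 2 = 1) (hc : ∀ w x : H, w ^ 2 = 1 → w * x = x * w)
    (hcard : {w : H | w ^ 2 = 1}.ncard = 8)
    (K : Subgroup H) (hWK : ∀ w : H, w ^ 2 = 1 → w ∈ K) (x y z : H) (hx : x ∈ K) (hy : y ∈ K)
    (hz : z ∉ K) (hx2 : x ^ 2 ≠ 1) (hy2 : y ^ 2 ≠ 1) (hxy : (x * y) ^ 2 ≠ 1) :
    RR (fun x y => x * y) 1 (cm x y) (cm x z) (cm y z) := by
  let W : Subgroup H :=
    { carrier := {w | w ^ 2 = 1}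
      one_mem' := one_pow 2
      mul_mem' := by
        intro u v hu hv
        have hu : u ^ 2 = 1 := hu
        have hv : v ^ 2 = 1 := hv
        change (u * v) ^ 2 = 1
        rw [(show Commute u v from hc u v hu).mul_pow, hu, hv, one_mul]
      inv_mem' := by
        intro u hu
        have hu : u ^ 2 = 1 := hu
        change (u⁻¹) ^ 2 = 1
        rw [inv_pow, hu, inv_one] }
  have hWc : Nat.card W = 8 := hcard
  have hW : ∀ w, w ∈ W ↔ w ^ 2 = 1 := fun w => Iff.rfl
  have hn : ∀ L : Subgroup H, W ≤ L → ∀ t, ∀ x ∈ L, t * x * t⁻¹ ∈ L := by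
    intro L hL t x hx
    have e : t * x * t⁻¹ = cm t x * x := by unfold cm; group
    rw [e]
    exact L.mul_mem (hL (cm_sq h4 hc t x)) hx
  have hs : ∀ t, t * t ∈ W := fun t => by rw [← sq]; exact h4 t
  obtain ⟨L1, hL1, hc1⟩ := ext_two W x (hn W le_rfl x) (hs x) hx2
  have i1 : W ≤ L1 := fun w hw => (hL1 w).2 (Or.inl hw)
  have hy1 : y ∉ L1 := by
    intro h
    rcases (hL1 y).1 h with h | h
    · exact hy2 h
    · apply hxy
      have e : x * y = x * (y * x) * x⁻¹ := by group
      rw [e, conj_pow_one]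
      exact h
  obtain ⟨L2, hL2, hc2⟩ := ext_two L1 y (hn L1 i1 y) (i1 (hs y)) hy1
  have i2 : W ≤ L2 := fun w hw => (hL2 w).2 (Or.inl (i1 hw))
  have hz2 : z ∉ L2 := by
    intro h
    apply hz
    have h1 : ∀ u ∈ L1, u ∈ K := by
      intro u hu
      rcases (hL1 u).1 hu with h | h
      · exact hWK u h
      · exact (K.mul_mem_cancel_right hx).1 (hWK _ h)
    rcases (hL2 z).1 h with h | h
    · exact h1 z h
    · exact (K.mul_mem_cancel_right hy).1 (h1 _ h)
  obtain ⟨M, hM, hc3⟩ := ext_two L2 z (hn L2 i2 z) (i2 (hs z)) hz2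
  have hMc : Nat.card M = 64 := by rw [hc3, hc2, hc1, hWc]
  have hxM : x ∈ M := (hM x).2 (Or.inl ((hL2 x).2 (Or.inl ((hL1 x).2 (Or.inr (hs x))))))
  have hyM : y ∈ M := (hM y).2 (Or.inl ((hL2 y).2 (Or.inr (i1 (hs y)))))
  have hzM : z ∈ M := (hM z).2 (Or.inr (i2 (hs z)))
  have hk : ∀ u ∈ K, (u * z) ^ 2 ≠ 1 := by
    intro u hu h
    exact hz ((K.mul_mem_cancel_left hu).1 (hWK _ h))
  exact (hall M hMc).P x hxM y hyM z hzM hx2 hy2 (fun h => hz (hWK z h)) hxy (hk x hx) (hk y hy)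
    (hk _ (K.mul_mem hx hy))

theorem case45 {H : Type*} [Group H] [Finite H] (hH : Nat.card H = 128)
    (hall : ∀ K : Subgroup H, Nat.card K = 64 → T45 K)
    (hmem : ∀ h : H, ∃ K : Subgroup H, Nat.card K = 64 ∧ h ∈ K) : False := by
  have hWall : ∀ M : Subgroup H, Nat.card M = 64 → ∀ w : H, w ^ 2 = 1 → w ∈ M := by
    intro M hM w hw
    obtain ⟨N, hN, hwN⟩ := hmem w
    obtain ⟨y, hy, z, hz, e⟩ := (hall N hN).sq2 w hwN hw
    rw [e]
    exact M.mul_mem (sq_mem64 hH M hM y) (sq_mem64 hH M hM z)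
  have h4 : ∀ h : H, (h ^ 2) ^ 2 = 1 := by
    intro h
    obtain ⟨M, hM, hh⟩ := hmem h
    rw [← pow_mul]
    exact (hall M hM).e4 h hh
  have hc : ∀ w x : H, w ^ 2 = 1 → w * x = x * w := by
    intro w x hw
    obtain ⟨M, hM, hx⟩ := hmem x
    exact (hall M hM).cen w (hWall M hM w hw) x hx hw
  obtain ⟨K, hK⟩ := exists64 hH
  have hWK := hWall K hK
  have hcard : {w : H | w ^ 2 = 1}.ncard = 8 := by
    rw [← (hall K hK).c2]
    congr 1
    ext w
    exact ⟨fun h => ⟨hWK w h, h⟩, fun h => h.2⟩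
  have hyp := hyper45 hall h4 hc hcard K hWK
  have cl := cm_mul_left h4 hc
  have cr := cm_mul_right h4 hc
  have cs := cm_symm h4 hc
  have c2 := cm_sq h4 hc
  obtain ⟨x, hx, y, hy, z, hz, cxy, ha1, hb1, hab, sx, sy, sz, sxy, sxz, syz, sxyz, hgen⟩ :=
    (hall K hK).ex
  obtain ⟨t, ht⟩ := exists_not_mem64 hH K hK
  have hxt : x * t ∉ K := fun h => ht ((K.mul_mem_cancel_left hx).1 h)
  have hzt : z * t ∉ K := fun h => ht ((K.mul_mem_cancel_left hz).1 h)
  have cyx : cm y x = 1 := by rw [cs, cxy]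
  have r1 := hyp y z t hy hz ht sy sz syz
  have r2 := hyp x y t hx hy ht sx sy sxy
  have r3 := hyp y (x * z) t hy (K.mul_mem hx hz) ht sy sxz (by
    have e : y * (x * z) = cm y x * (x * y * z) := by unfold cm; group
    rw [e, cyx, one_mul]; exact sxyz)
  have r4 := hyp y z (x * t) hy hz hxt sy sz syz
  have r5 := hyp x y (z * t) hx hy hzt sx sy sxy
  rw [cxy] at r2 r5
  rw [cr y x z, cyx, one_mul, cl x z t] at r3
  rw [cr y x t, cyx, one_mul, cr z x t, cs z x] at r4
  rw [cr x z t, cr y z t] at r5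
  -- coordinates
  obtain ⟨e, he2, hne⟩ : ∃ e ∈ {w : H | w ^ 2 = 1}, e ∉
      om (cm x z) (cm y z) 1 '' ((Finset.range 4 : Finset ℕ) : Set ℕ) := by
    by_contra! h
    have h1 := Set.ncard_le_ncard h (Set.toFinite _)
    have h2 := Set.ncard_image_le (f := om (cm x z) (cm y z) 1)
      (Set.toFinite ((Finset.range 4 : Finset ℕ) : Set ℕ))
    rw [Set.ncard_coe_finset, Finset.card_range] at h2
    rw [hcard] at h1
    omega
  have he2 : e ^ 2 = 1 := he2
  have hne' : ∀ i < 4, e ≠ om (cm x z) (cm y z) 1 i := by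
    intro i hi h
    exact hne ⟨i, by simpa using hi, h.symm⟩
  have he1 : e ≠ 1 := by simpa [om] using hne' 0 (by norm_num)
  have hea : e ≠ cm x z := by simpa [om] using hne' 1 (by norm_num)
  have heb : e ≠ cm y z := by simpa [om] using hne' 2 (by norm_num)
  have heab : e ≠ cm x z * cm y z := by simpa [om] using hne' 3 (by norm_num)
  have om1 := om_one (cm x z) (cm y z) e (c2 y z) he2 ha1 hb1 hab he1 hea heb heab
  have omm := om_mul hc (cm x z) (cm y z) e (c2 x z) (c2 y z) he2
  have oms := om_surj hc (cm x z) (cm y z) e (c2 x z) (c2 y z) he2 om1 hcard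
  have o0 : (1 : H) = om (cm x z) (cm y z) e 0 := by simp [om]
  have oa : cm x z = om (cm x z) (cm y z) e 1 := by simp [om]
  have ob : cm y z = om (cm x z) (cm y z) e 2 := by simp [om]
  generalize om (cm x z) (cm y z) e = f at *
  have f0 : f 0 = 1 := o0.symm
  let D : Subgroup H :=
    { carrier := {w | ∃ i < 4, f i = w}
      one_mem' := ⟨0, by norm_num, f0⟩
      mul_mem' := by
        rintro _ _ ⟨i, hi, rfl⟩ ⟨j, hj, rfl⟩
        exact ⟨i ^^^ j, Nat.xor_lt_two_pow (n := 2) hi hj, omm i (by omega) j (by omega)⟩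
      inv_mem' := by
        rintro _ ⟨i, hi, rfl⟩
        refine ⟨i, hi, ?_⟩
        rw [eq_inv_iff_mul_eq_one, ← omm i (by omega) i (by omega), Nat.xor_self, f0] }
  have hD : ∀ i < 4, f i ∈ D := fun i hi => ⟨i, hi, rfl⟩
  have haD : cm x z ∈ D := by rw [oa]; exact hD 1 (by norm_num)
  have hbD : cm y z ∈ D := by rw [ob]; exact hD 2 (by norm_num)
  have hpqr : cm x t ∈ D ∧ cm y t ∈ D ∧ cm z t ∈ D := by
    obtain ⟨i, hi, ei⟩ := oms (cm x t) (c2 x t)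
    obtain ⟨j, hj, ej⟩ := oms (cm y t) (c2 y t)
    obtain ⟨k, hk, ek⟩ := oms (cm z t) (c2 z t)
    have s2 : RR (fun x y => x * y) 1 (f 0) (f i) (f j) := by
      rw [f0, ei, ej]; exact r2
    have s5 : RR (fun x y => x * y) 1 (f 0) (f (1 ^^^ i)) (f (2 ^^^ j)) := by
      rw [omm 1 (by norm_num) i hi, omm 2 (by norm_num) j hj, f0, ← oa, ← ob, ei, ej]; exact r5
    have s1 : RR (fun x y => x * y) 1 (f 2) (f j) (f k) := by
      rw [← ob, ej, ek]; exact r1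
    have s3 : RR (fun x y => x * y) 1 (f 2) (f j) (f (i ^^^ k)) := by
      rw [omm i hi k hk, ← ob, ej, ei, ek]; exact r3
    have s4 : RR (fun x y => x * y) 1 (f 2) (f j) (f (1 ^^^ k)) := by
      rw [omm 1 (by norm_num) k hk, ← ob, ← oa, ej, ek]; exact r4
    rw [RR_map f omm om1 (by norm_num) hi hj] at s2
    rw [RR_map f omm om1 (by norm_num) (xor_lt_eight (by norm_num) hi)
      (xor_lt_eight (by norm_num) hj)] at s5
    rw [RR_map f omm om1 (by norm_num) hj hk] at s1
    rw [RR_map f omm om1 (by norm_num) hj (xor_lt_eight hi hk)] at s3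
    rw [RR_map f omm om1 (by norm_num) hj (xor_lt_eight (by norm_num) hk)] at s4
    obtain ⟨li, lj, lk⟩ := core45 i hi j hj k hk ⟨s2, s5, s1, s3, s4⟩
    exact ⟨⟨i, li, ei⟩, ⟨j, lj, ej⟩, ⟨k, lk, ek⟩⟩
  obtain ⟨hp, hq, hr⟩ := hpqr
  -- all commutators lie in `D`
  have hgen' : ∀ S : Subgroup H, x ∈ S → y ∈ S → z ∈ S → t ∈ S → (∀ w : H, w ^ 2 = 1 → w ∈ S) →
      ∀ h, h ∈ S := by
    intro S h1 h2 h3 h5 h6 h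
    have hKS := hgen S h1 h2 h3 (fun w _ hw => h6 w hw)
    by_cases hh : h ∈ K
    · exact hKS hh
    · have : h * t ∈ K := (mul_mem64 hH K hK h t).2 (by simp [hh, ht])
      exact (S.mul_mem_cancel_right h5).1 (hKS this)
  let C : H → Subgroup H := fun u =>
    { carrier := {v | cm u v ∈ D}
      one_mem' := by
        change cm u 1 ∈ D
        rw [cm_cen hc u 1 (one_pow 2)]; exact D.one_mem
      mul_mem' := by
        intro v w hv hw
        change cm u (v * w) ∈ D
        rw [cr]; exact D.mul_mem hv hw
      inv_mem' := by
        intro v hv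
        change cm u v⁻¹ ∈ D
        have h1 : cm u v⁻¹ * cm u v = 1 := by
          rw [← cr, inv_mul_cancel, cm_cen hc u 1 (one_pow 2)]
        rw [eq_inv_of_mul_eq_one_left h1]
        exact D.inv_mem hv }
  have hC : ∀ u v, v ∈ C u ↔ cm u v ∈ D := fun u v => Iff.rfl
  have hCw : ∀ u w : H, w ^ 2 = 1 → w ∈ C u := by
    intro u w hw
    rw [hC, cm_cen hc u w hw]; exact D.one_mem
  have hself : ∀ u, u ∈ C u := by
    intro u; rw [hC, cm_self]; exact D.one_mem
  have hsw : ∀ u v, u ∈ C v ↔ v ∈ C u := by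
    intro u v; rw [hC, hC, cs]
  have hxC : ∀ h, h ∈ C x := hgen' (C x) (hself x) (by rw [hC, cxy]; exact D.one_mem) haD hp (hCw x)
  have hyC : ∀ h, h ∈ C y := hgen' (C y) ((hsw _ _).1 (hxC y)) (hself y) hbD hq (hCw y)
  have hzC : ∀ h, h ∈ C z := hgen' (C z) ((hsw _ _).1 (hxC z)) ((hsw _ _).1 (hyC z)) (hself z) hr
    (hCw z)
  have hcD : ∀ u v, cm u v ∈ D := by
    intro u
    exact hgen' (C u) ((hsw _ _).1 (hxC u)) ((hsw _ _).1 (hyC u)) ((hsw _ _).1 (hzC u))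
      (hgen' (C t) ((hsw _ _).1 (hxC t)) ((hsw _ _).1 (hyC t)) ((hsw _ _).1 (hzC t)) (hself t)
        (hCw t) u |> (hsw _ _).1) (hCw u)
  -- a subgroup of order 64 whose squares lie in `D`
  obtain ⟨M, hM, hMD⟩ : ∃ M : Subgroup H, Nat.card M = 64 ∧ ∀ u ∈ M, u ^ 2 ∈ D := by
    by_cases hall' : ∀ u : H, u ^ 2 ∈ D
    · exact ⟨K, hK, fun u _ => hall' u⟩
    · push Not at hall'
      obtain ⟨u, hu⟩ := hall'
      let Q : Subgroup H :=
        { carrier := {v | v ^ 2 ∈ D}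
          one_mem' := by
            change (1 : H) ^ 2 ∈ D
            rw [one_pow]; exact D.one_mem
          mul_mem' := by
            intro v w hv hw
            change (v * w) ^ 2 ∈ D
            rw [sq_mul_eq v w hc h4]
            exact D.mul_mem (D.mul_mem hv hw) (hcD _ _)
          inv_mem' := by
            intro v hv
            change (v⁻¹) ^ 2 ∈ D
            rw [inv_pow]
            exact D.inv_mem hv }
      have hQ : ∀ v, v ∈ Q ↔ v ^ 2 ∈ D := fun v => Iff.rfl
      have hge : ∀ v : H, v ^ 2 ∉ D → ∃ i < 8, 4 ≤ i ∧ f i = v ^ 2 := by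
        intro v hv
        obtain ⟨i, hi, ei⟩ := oms (v ^ 2) (h4 v)
        refine ⟨i, hi, ?_, ei⟩
        by_contra! h
        exact hv ⟨i, h, ei⟩
      have hxor : ∀ i < 8, ∀ j < 8, 4 ≤ i → 4 ≤ j → i ^^^ j < 4 := by decide
      have hidx : Q.index = 2 := by
        rw [Subgroup.index_eq_two_iff]
        refine ⟨u, fun v => ?_⟩
        by_cases hv : v ∈ Q
        · exact Or.inr ⟨hv, fun h => hu ((Q.mul_mem_cancel_left hv).1 h)⟩
        · refine Or.inl ⟨?_, hv⟩
          rw [hQ, sq_mul_eq v u hc h4]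
          refine D.mul_mem ?_ (hcD _ _)
          obtain ⟨i, hi, hi4, ei⟩ := hge v hv
          obtain ⟨j, hj, hj4, ej⟩ := hge u hu
          rw [← ei, ← ej, ← omm i hi j hj]
          exact hD _ (hxor i hi j hj hi4 hj4)
      have := Q.card_mul_index
      rw [hidx, hH] at this
      exact ⟨Q, by omega, fun v hv => hv⟩
  have h1 := (hall M hM).csq
  have h2 : {v | v ∈ M ∧ ∃ w ∈ M, v = w ^ 2} ⊆ f '' ((Finset.range 4 : Finset ℕ) : Set ℕ) := by
    rintro v ⟨_, w, hw, rfl⟩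
    obtain ⟨i, hi, ei⟩ := hMD w hw
    exact ⟨i, by simpa using hi, ei⟩
  have h3 := Set.ncard_le_ncard h2 (Set.toFinite _)
  have h5 := Set.ncard_image_le (f := f) (Set.toFinite ((Finset.range 4 : Finset ℕ) : Set ℕ))
  rw [Set.ncard_coe_finset, Finset.card_range] at h5
  omega


/-- There is no group `H` of order 128 all of whose subgroups of order 64 are isomorphic
to one of the five groups `(64,2) = ℤ/8 × ℤ/8`, `(64,3)`, `(64,68)`, `(64,72)`, `(64,179)`,
here realized as the explicit subgroups `G₁ = ⟨τ, (12345678)⟩`, `G₂ = ⟨τ, (18325476)⟩`,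
`G₄ = ⟨σ₁, σ₂, σ₃⟩`, `G₅ = ⟨σ₃, σ₄, σ₅⟩` and `G₃ = ⟨τ, (1357)(2468), (1256)(4387)⟩`
of `PGL(8, ℂ)` from the paper (with `τ = diag(1, ξ, …, ξ⁷)`): equivalently, every group of
order 128 has a subgroup of order 64 isomorphic to none of these five groups. -/
theorem no_128_group_with_only_these_64_subgroups
    (ξ : ℂˣ) (hξ : IsPrimitiveRoot (ξ : ℂ) 8) :
    let τ : PGL8 := mk8 (fun i => ξ ^ (i : ℕ)) 1
    let G₁ := Subgroup.closure {τ, mk8 1 (finRotate 8)}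
    let G₂ := Subgroup.closure {τ, mk8 1 ([(0 : Fin 8), 7, 2, 1, 4, 3, 6, 5].formPerm)}
    let G₃ := Subgroup.closure {τ,
      mk8 1 ([(0 : Fin 8), 2, 4, 6].formPerm * [(1 : Fin 8), 3, 5, 7].formPerm),
      mk8 1 ([(0 : Fin 8), 1, 4, 5].formPerm * [(3 : Fin 8), 2, 7, 6].formPerm)}
    let σ₁ := mk8 ![ξ, ξ, ξ ^ 3, ξ ^ 3, -ξ, -ξ, ξ ^ 3, ξ ^ 3] eA
    let σ₂ := mk8 ![-1, Iu, -1, -Iu, -Iu, 1, Iu, 1] eB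
    let σ₃ := mk8 ![ξ ^ 3, -ξ ^ 3, -ξ, ξ, ξ ^ 3, -ξ ^ 3, -ξ, ξ] eC
    let σ₄ := mk8 ![ξ, ξ, -ξ ^ 3, ξ ^ 3, -ξ, -ξ, ξ ^ 3, -ξ ^ 3] eA
    let σ₅ := mk8 ![ξ ^ 3, ξ ^ 3, -ξ, ξ, ξ ^ 3, ξ ^ 3, ξ, -ξ] eD
    let G₄ := Subgroup.closure {σ₁, σ₂, σ₃}
    let G₅ := Subgroup.closure {σ₃, σ₄, σ₅}
    ∀ (H : Type) [Group H] [Finite H], Nat.card H = 128 →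
      ∃ K : Subgroup H, Nat.card K = 64 ∧
        ¬ Nonempty (K ≃* G₁) ∧ ¬ Nonempty (K ≃* G₂) ∧ ¬ Nonempty (K ≃* G₃) ∧
        ¬ Nonempty (K ≃* G₄) ∧ ¬ Nonempty (K ≃* G₅) := by
  intro τ G₁ G₂ G₃ σ₁ σ₂ σ₃ σ₄ σ₅ G₄ G₅ H _ _ hH
  by_contra hcon
  have hT : ∀ K : Subgroup H, Nat.card K = 64 → T12 K ∨ T3 K ∨ T45 K := by
    intro K hK
    by_contra hno
    have n1 : ¬ T12 K := fun h => hno (Or.inl h)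
    have n2 : ¬ T3 K := fun h => hno (Or.inr (Or.inl h))
    have n3 : ¬ T45 K := fun h => hno (Or.inr (Or.inr h))
    refine hcon ⟨K, hK, ?_, ?_, ?_, ?_, ?_⟩
    · rintro ⟨e⟩
      obtain ⟨r, hr⟩ := model1 ξ hξ K hK e
      exact n1 (t12_of_one hr)
    · rintro ⟨e⟩
      obtain ⟨r, hr⟩ := model2 ξ hξ K hK e
      exact n1 (t12_of_two hr)
    · rintro ⟨e⟩
      obtain ⟨r, hr⟩ := model3 ξ hξ K hK e
      exact n2 (t3_of hr)
    · rintro ⟨e⟩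
      obtain ⟨r, hr⟩ := model4 ξ hξ K hK e
      exact n3 (t45_of_four hr)
    · rintro ⟨e⟩
      obtain ⟨r, hr⟩ := model5 ξ hξ K hK e
      exact n3 (t45_of_five hr)
  have h8 : ∀ K : Subgroup H, Nat.card K = 64 → ∀ x ∈ K, x ^ 8 = 1 := by
    intro K hK x hx
    rcases hT K hK with h | h | h
    · exact h.e8 x hx
    · exact h.e8 x hx
    · rw [show 8 = 4 * 2 by norm_num, pow_mul, h.e4 x hx, one_pow]
  have hmem := exists_mem64 hH h8
  by_cases h12 : ∃ K : Subgroup H, Nat.card K = 64 ∧ T12 K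
  · obtain ⟨K, hK, h⟩ := h12
    exact case12 hH hT (pow_eight hH h8) K hK h
  have hT2 : ∀ K : Subgroup H, Nat.card K = 64 → T3 K ∨ T45 K := by
    intro K hK
    exact (hT K hK).resolve_left fun h => h12 ⟨K, hK, h⟩
  by_cases h3 : ∃ K : Subgroup H, Nat.card K = 64 ∧ T3 K
  · obtain ⟨K, hK, h⟩ := h3
    exact case3 hH hT2 hmem K hK h
  exact case45 hH (fun K hK => (hT2 K hK).resolve_left fun h => h3 ⟨K, hK, h⟩) hmem
end
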